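/- The Hanf number of the countable-set-quantifier logic is at most that of stationary logic: h(L^c_{ω,ω}) ≤ h(L^{aa}_{ω,ω}). -/

import Mathlib

open FirstOrder Cardinal

namespace Hanf

/-- Formulas of (extensions of) infinitary first-order logic over a vocabulary `L`:
first-order logic with equality, infinitary conjunctions, monadic second-order
(set) variables, binary relation variables, and the quantifiers
`wo` (well-ordering), `∃^c` (countable set), `aa` (stationary), `∃R` (second order),
and `Q^{cf}_{ℵ₀}` (countable cofinality). -/
inductive Fml (L : FirstOrder.Language.{0,0}) : Type 1
  | rel : {n : ℕ} → L.Relations n → (Fin n → L.Term ℕ) → Fml L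
  | eq : L.Term ℕ → L.Term ℕ → Fml L
  | mem : ℕ → L.Term ℕ → Fml L
  | rmem : ℕ → L.Term ℕ → L.Term ℕ → Fml L
  | not : Fml L → Fml L
  | conj : (ι : Type) → (ι → Fml L) → Fml L
  | all : ℕ → Fml L → Fml L
  | qWo : ℕ → ℕ → Fml L → Fml L
  | qC : ℕ → Fml L → Fml L
  | qAA : ℕ → Fml L → Fml L
  | qII : ℕ → Fml L → Fml L
  | qCf : ℕ → ℕ → Fml L → Fml L

variable {L : FirstOrder.Language.{0,0}}

/-- A family of countable subsets of `M` which is closed under unions of countable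
increasing chains and cofinal (under `⊆`) in the countable subsets of `M`. -/
def IsClubFam {M : Type} (C : Set (Set M)) : Prop :=
  (∀ S ∈ C, S.Countable) ∧
  (∀ f : ℕ → Set M, (∀ n, f n ∈ C) → Monotone f → (⋃ n, f n) ∈ C) ∧
  (∀ S : Set M, S.Countable → ∃ T ∈ C, S ⊆ T)

/-- The field of a binary relation. -/
def fieldOf {M : Type} (r : M → M → Prop) : Set M :=
  {a | (∃ b, r a b) ∨ ∃ b, r b a}

/-- `r` well-orders its field. -/
def WellOrdersField {M : Type} (r : M → M → Prop) : Prop :=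
  IsWellOrder (fieldOf r) (fun a b => r a.1 b.1)

/-- `r` is a linear order of its field, of cofinality `ℵ₀`:
it is irreflexive, transitive and trichotomous on its field, some countable
sequence is cofinal in it, and it has no maximal element. -/
def LinearOrdersFieldCofOmega {M : Type} (r : M → M → Prop) : Prop :=
  (∀ a ∈ fieldOf r, ¬ r a a) ∧
  (∀ a ∈ fieldOf r, ∀ b ∈ fieldOf r, ∀ c ∈ fieldOf r, r a b → r b c → r a c) ∧
  (∀ a ∈ fieldOf r, ∀ b ∈ fieldOf r, a ≠ b → r a b ∨ r b a) ∧
  (∃ c : ℕ → M, (∀ n, c n ∈ fieldOf r) ∧ ∀ a ∈ fieldOf r, ∃ n, a = c n ∨ r a (c n)) ∧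
  (∀ a ∈ fieldOf r, ∃ b ∈ fieldOf r, r a b)

/-- Satisfaction, relative to assignments of the first-order variables,
the monadic (set) variables and the binary relation variables. -/
def Eval {M : Type} [L.Structure M] :
    Fml L → (ℕ → M) → (ℕ → Set M) → (ℕ → M → M → Prop) → Prop
  | .rel R ts, va, _, _ => Language.Structure.RelMap R (fun i => (ts i).realize va)
  | .eq t₁ t₂, va, _, _ => t₁.realize va = t₂.realize va
  | .mem X t, va, vs, _ => t.realize va ∈ vs X
  | .rmem R t₁ t₂, va, _, vr => vr R (t₁.realize va) (t₂.realize va)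
  | .not φ, va, vs, vr => ¬ Eval φ va vs vr
  | .conj _ f, va, vs, vr => ∀ i, Eval (f i) va vs vr
  | .all x φ, va, vs, vr => ∀ a, Eval φ (Function.update va x a) vs vr
  | .qWo x y φ, va, vs, vr =>
      WellOrdersField (fun a b =>
        Eval φ (Function.update (Function.update va x a) y b) vs vr)
  | .qC X φ, va, vs, vr => ∃ S : Set M, S.Countable ∧ Eval φ va (Function.update vs X S) vr
  | .qAA X φ, va, vs, vr =>
      ∃ C : Set (Set M), IsClubFam C ∧ ∀ S ∈ C, Eval φ va (Function.update vs X S) vr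
  | .qII R φ, va, vs, vr => ∃ r : M → M → Prop, Eval φ va vs (Function.update vr R r)
  | .qCf x y φ, va, vs, vr =>
      LinearOrdersFieldCofOmega (fun a b =>
        Eval φ (Function.update (Function.update va x a) y b) vs vr)

/-- The variables of a term. -/
def tvars : L.Term ℕ → Set ℕ
  | .var i => {i}
  | .func _ ts => ⋃ i, tvars (ts i)

/-- Free first-order variables. -/
def fv : Fml L → Set ℕ
  | .rel _ ts => ⋃ i, tvars (ts i)
  | .eq t₁ t₂ => tvars t₁ ∪ tvars t₂
  | .mem _ t => tvars t
  | .rmem _ t₁ t₂ => tvars t₁ ∪ tvars t₂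
  | .not φ => fv φ
  | .conj _ f => ⋃ i, fv (f i)
  | .all x φ => fv φ \ {x}
  | .qWo x y φ => fv φ \ {x, y}
  | .qC _ φ => fv φ
  | .qAA _ φ => fv φ
  | .qII _ φ => fv φ
  | .qCf x y φ => fv φ \ {x, y}

/-- Free monadic (set) variables. -/
def sv : Fml L → Set ℕ
  | .rel _ _ => ∅
  | .eq _ _ => ∅
  | .mem X _ => {X}
  | .rmem _ _ _ => ∅
  | .not φ => sv φ
  | .conj _ f => ⋃ i, sv (f i)
  | .all _ φ => sv φ
  | .qWo _ _ φ => sv φ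
  | .qC X φ => sv φ \ {X}
  | .qAA X φ => sv φ \ {X}
  | .qII _ φ => sv φ
  | .qCf _ _ φ => sv φ

/-- Free binary relation variables. -/
def rv : Fml L → Set ℕ
  | .rel _ _ => ∅
  | .eq _ _ => ∅
  | .mem _ _ => ∅
  | .rmem R _ _ => {R}
  | .not φ => rv φ
  | .conj _ f => ⋃ i, rv (f i)
  | .all _ φ => rv φ
  | .qWo _ _ φ => rv φ
  | .qC _ φ => rv φ
  | .qAA _ φ => rv φ
  | .qII R φ => rv φ \ {R}
  | .qCf _ _ φ => rv φ

/-- A sentence: no free variables of any kind. -/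
def IsSentence (φ : Fml L) : Prop := fv φ = ∅ ∧ sv φ = ∅ ∧ rv φ = ∅

/-- Which extra quantifiers a logic allows, and the bound on the size
of its conjunctions (`conjBound = ℵ₀` gives finitary logic). -/
structure Allowed where
  wo : Prop
  c : Prop
  aa : Prop
  ii : Prop
  cf : Prop
  conjBound : Cardinal.{0}

/-- The formula lies in the logic described by `A`. -/
def Ok (A : Allowed) : Fml L → Prop
  | .rel _ _ => True
  | .eq _ _ => True
  | .mem _ _ => True
  | .rmem _ _ _ => True
  | .not φ => Ok A φ
  | .conj ι f => #ι < A.conjBound ∧ ∀ i, Ok A (f i)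
  | .all _ φ => Ok A φ
  | .qWo _ _ φ => A.wo ∧ Ok A φ
  | .qC _ φ => A.c ∧ Ok A φ
  | .qAA _ φ => A.aa ∧ Ok A φ
  | .qII _ φ => A.ii ∧ Ok A φ
  | .qCf _ _ φ => A.cf ∧ Ok A φ

/-- `M ⊨ φ` (for sentences this does not depend on the assignments). -/
def Sat (M : Type) [L.Structure M] (φ : Fml L) : Prop :=
  ∀ (va : ℕ → M) (vs : ℕ → Set M) (vr : ℕ → M → M → Prop), Eval φ va vs vr

/-- `h(φ) < ∞`: `φ` has no models of arbitrarily large cardinality. -/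
def BddSpec (φ : Fml L) : Prop :=
  ∃ κ : Cardinal, ∀ (M : Type) (S : L.Structure M), @Sat L M S φ → #M < κ

/-- The Hanf value `h(φ) = sup {|M|⁺ : M ⊨ φ}`. -/
noncomputable def hanfVal (φ : Fml L) : Cardinal :=
  sSup {c | ∃ (M : Type) (S : L.Structure M), @Sat L M S φ ∧ c = Order.succ #M}

/-- The Hanf number of the logic `A`: the supremum of `h(φ)` over all
sentences `φ` of the logic (in any vocabulary) with `h(φ) < ∞`. -/
noncomputable def hanfNum (A : Allowed) : Cardinal :=
  sSup {c | ∃ (L : FirstOrder.Language.{0,0}) (φ : Fml L),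
    IsSentence φ ∧ Ok A φ ∧ BddSpec φ ∧ c = hanfVal φ}

/-- The Hanf number of the logic `A` computed over vocabularies of cardinality `≤ χ`. -/
noncomputable def hanfNumVocab (A : Allowed) (χ : Cardinal) : Cardinal :=
  sSup {c | ∃ (L : FirstOrder.Language.{0,0}), L.card ≤ χ ∧ ∃ φ : Fml L,
    IsSentence φ ∧ Ok A φ ∧ BddSpec φ ∧ c = hanfVal φ}

/-- `L^{wo}_{ω,ω}`. -/
def Lwo : Allowed := ⟨True, False, False, False, False, ℵ₀⟩
/-- `L^c_{ω,ω}`. -/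
def Lc : Allowed := ⟨False, True, False, False, False, ℵ₀⟩
/-- `L^{aa}_{ω,ω}`. -/
def Laa : Allowed := ⟨False, False, True, False, False, ℵ₀⟩
/-- `L^{II}_{ω,ω}`. -/
def LII : Allowed := ⟨False, False, False, True, False, ℵ₀⟩
/-- `L_{ω,ω}(Q^{cf}_{ℵ₀})`. -/
def Lcf : Allowed := ⟨False, False, False, False, True, ℵ₀⟩
/-- `L^{wo}_{κ,ω}`: conjunctions of `< κ` formulas. -/
def LwoInf (κ : Cardinal) : Allowed := ⟨True, False, False, False, False, κ⟩
/-- `L^c_{κ,ω}`. -/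
def LcInf (κ : Cardinal) : Allowed := ⟨False, True, False, False, False, κ⟩
/-- `L^{II}_{κ,ω}`. -/
def LIIInf (κ : Cardinal) : Allowed := ⟨False, False, False, True, False, κ⟩



/-! ### Combinatorics on long well-orders -/

/-- `Λ` behaves like a regular cardinal `𝔠⁺`. -/
structure Reg (Λ : Type) [LinearOrder Λ] : Prop where
  hB : ∀ (ι : Type) (f : ι → Λ), #ι ≤ 𝔠 → ∃ b, ∀ i, f i < b
  hI : ∀ b : Λ, #(Set.Iic b) ≤ 𝔠

lemma toType_bdd (κ : Cardinal.{0}) (hκ : ℵ₀ ≤ κ) (ι : Type)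
    (f : ι → (Order.succ κ).ord.ToType) (hι : #ι ≤ κ) : ∃ b, ∀ i, f i < b := by
  by_contra hcon
  push Not at hcon
  have h1 : IsCofinal (Set.range f) := by
    intro b
    obtain ⟨i, hi⟩ := hcon b
    exact ⟨f i, ⟨i, rfl⟩, hi⟩
  have h2 := Order.cof_le h1
  have h3 : Order.cof (Order.succ κ).ord.ToType = Order.succ κ := by
    have := (isRegular_succ hκ).cof_ord
    simpa using this
  rw [h3] at h2
  have h4 : #(Set.range f) ≤ #ι := Cardinal.mk_range_le
  exact absurd (h2.trans (h4.trans hι)) (not_le.2 (Order.lt_succ κ))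

lemma reg_toType : Reg (Order.succ 𝔠).ord.ToType where
  hB := fun ι f h => toType_bdd 𝔠 Cardinal.aleph0_le_continuum ι f h
  hI := fun b => by
    obtain ⟨c, hc⟩ := toType_bdd 𝔠 Cardinal.aleph0_le_continuum Unit (fun _ => b)
      (by simpa using (Cardinal.one_lt_aleph0.le.trans Cardinal.aleph0_le_continuum))
    have h1 : #(Set.Iic b) ≤ #(Set.Iio c) :=
      Cardinal.mk_le_mk_of_subset (fun x hx => lt_of_le_of_lt hx (hc ()))
    exact h1.trans (Order.lt_succ_iff.1 (Cardinal.mk_Iio_toType_ord_lt c))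

section Lam

variable {Λ : Type} [LinearOrder Λ] [WellFoundedLT Λ]

lemma Reg.countable (h : Reg Λ) {s : Set Λ} (hs : s.Countable) : ∃ b, ∀ x ∈ s, x < b := by
  obtain ⟨b, hb⟩ := h.hB s (fun x => x.1)
    ((Cardinal.le_aleph0_iff_set_countable.2 hs).trans Cardinal.aleph0_le_continuum)
  exact ⟨b, fun x hx => hb ⟨x, hx⟩⟩

lemma Reg.two (h : Reg Λ) (x y : Λ) : ∃ b, x < b ∧ y < b := by
  obtain ⟨b, hb⟩ := h.countable (s := {x, y}) (by simp)
  exact ⟨b, hb x (by simp), hb y (by simp)⟩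

lemma Reg.sub (h : Reg Λ) (T : Set Λ) (hT : ∀ b, ∃ t ∈ T, b < t) : Reg T where
  hB := fun ι f hι => by
    obtain ⟨b, hb⟩ := h.hB ι (fun i => (f i).1) hι
    obtain ⟨t, ht, hbt⟩ := hT b
    exact ⟨⟨t, ht⟩, fun i => (hb i).trans hbt⟩
  hI := fun b => by
    refine le_trans ?_ (h.hI b.1)
    refine Cardinal.mk_le_of_injective (f := fun x : Set.Iic b => (⟨x.1.1, x.2⟩ : Set.Iic b.1)) ?_
    intro x y hxy
    simpa [Subtype.ext_iff] using hxy

/-- Points of uncountable cofinality closed under `c`. -/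
lemma Reg.closedPt (h : Reg Λ) (c : Λ → Λ) (b : Λ) : ∃ α, b < α ∧ (∀ β < α, c β < α) ∧
    ∀ s : Set Λ, s.Countable → ∃ g < α, ∀ x ∈ s, x < α → x < g := by
  classical
  have hc' : ∀ b : Λ, ∃ d, b < d ∧ ∀ β ≤ b, c β < d := by
    intro b
    obtain ⟨d, hd⟩ := h.hB (Set.Iic b) (fun x => c x.1) (h.hI b)
    obtain ⟨e, he1, he2⟩ := h.two b d
    exact ⟨e, he1, fun β hβ => (hd ⟨β, hβ⟩).trans he2⟩
  choose c' hc1 hc2 using hc'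
  let I := (Order.succ ℵ₀).ord.ToType
  have hI : #I ≤ 𝔠 := by
    simp only [I, Cardinal.mk_ord_toType]
    exact Order.succ_le_of_lt Cardinal.aleph0_lt_continuum
  have hbd : ∀ (i : I) (g : ∀ j, j < i → Λ), ∃ d, b < d ∧ ∀ j (hj : j < i), c' (g j hj) < d := by
    intro i g
    obtain ⟨d, hd⟩ := h.hB (Set.Iio i) (fun x => c' (g x.1 x.2)) ((Cardinal.mk_set_le _).trans hI)
    obtain ⟨e, he1, he2⟩ := h.two b d
    exact ⟨e, he1, fun j hj => (hd ⟨j, hj⟩).trans he2⟩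
  choose nx hnx1 hnx2 using hbd
  let f : I → Λ := (wellFounded_lt (α := I)).fix nx
  have hf : ∀ i, f i = nx i (fun j _ => f j) := fun i => WellFounded.fix_eq _ _ _
  have f1 : ∀ i, b < f i := fun i => by rw [hf]; exact hnx1 _ _
  have f2 : ∀ i j, j < i → c' (f j) < f i := fun i j hj => by
    rw [hf i]; exact hnx2 i (fun j _ => f j) j hj
  have hne : {α : Λ | ∀ i, f i < α}.Nonempty := h.hB I f hI
  let α := (wellFounded_lt (α := Λ)).min _ hne
  have hα : ∀ i, f i < α := (wellFounded_lt (α := Λ)).min_mem _ hne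
  have hα2 : ∀ β < α, ∃ i, β ≤ f i := by
    intro β hβ
    by_contra hcon
    push Not at hcon
    exact (wellFounded_lt (α := Λ)).not_lt_min {α : Λ | ∀ i, f i < α} (x := β) hcon hβ
  have hIb : ∀ s : Set I, s.Countable → ∃ i, ∀ x ∈ s, x < i := by
    intro s hs
    obtain ⟨i, hi⟩ := toType_bdd ℵ₀ le_rfl s (fun x => x.1) (Cardinal.le_aleph0_iff_set_countable.2 hs)
    exact ⟨i, fun x hx => hi ⟨x, hx⟩⟩
  obtain ⟨i0, -⟩ := hIb ∅ (by simp)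
  refine ⟨α, (f1 i0).trans (hα i0), ?_, ?_⟩
  · intro β hβ
    obtain ⟨i, hi⟩ := hα2 β hβ
    obtain ⟨j, hj⟩ := hIb {i} (by simp)
    exact ((hc2 _ _ hi).trans (f2 j i (hj i rfl))).trans (hα j)
  · intro s hs
    have : ∀ x : Λ, ∃ i, x < α → x ≤ f i := by
      intro x
      by_cases hx : x < α
      · obtain ⟨i, hi⟩ := hα2 x hx
        exact ⟨i, fun _ => hi⟩
      · exact ⟨i0, fun h => absurd h hx⟩
    choose k hk using this
    obtain ⟨i, hi⟩ := hIb (k '' s) (hs.image k)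
    refine ⟨f i, hα i, fun x hx hxα => ?_⟩
    exact ((hk x hxα).trans_lt (hc1 _)).trans (f2 i _ (hi _ ⟨x, hx, rfl⟩))

/-- A position violates the gap condition. -/
def Viol (F : List Λ → Set Λ) (q : List (Λ × Λ)) : Prop :=
  ∃ u ∈ q, ∃ x ∈ F (q.map Prod.snd), u.1 ≤ x ∧ x < u.2

/-- Positions from which the closed player loses. -/
inductive Bad (F : List Λ → Set Λ) : List (Λ × Λ) → Prop
  | viol (q) : Viol F q → Bad F q
  | step (q) (η : Λ) (ξ : Λ → Λ) : (∀ γ α, η ≤ γ → ξ γ ≤ α → Bad F ((γ, α) :: q)) → Bad F q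

/-- The position after `k` rounds. -/
def pl (q : List (Λ × Λ)) (γ α : ℕ → Λ) : ℕ → List (Λ × Λ)
  | 0 => q
  | k + 1 => (γ k, α k) :: pl q γ α k

lemma pl_shift (q : List (Λ × Λ)) (γ α : ℕ → Λ) (k : ℕ) :
    pl q γ α (k + 1) = pl ((γ 0, α 0) :: q) (fun n => γ (n + 1)) (fun n => α (n + 1)) k := by
  induction k with
  | zero => rfl
  | succ k ih =>
    rw [pl, ih]
    rfl

lemma mem_pl (γ α : ℕ → Λ) (k : ℕ) (u : Λ × Λ) (hu : u ∈ pl [] γ α k) :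
    ∃ n, u = (γ n, α n) := by
  induction k with
  | zero => simp [pl] at hu
  | succ k ih =>
    simp only [pl, List.mem_cons] at hu
    rcases hu with rfl | hu
    · exact ⟨k, rfl⟩
    · exact ih hu

lemma pl_snd (γ γ' α : ℕ → Λ) (k : ℕ) :
    (pl [] γ α k).map Prod.snd = (pl [] γ' α k).map Prod.snd := by
  induction k with
  | zero => rfl
  | succ k ih => simp [pl, ih]

lemma bad_aux (h : Reg Λ) (F : List Λ → Set Λ) (q : List (Λ × Λ)) (hq : Bad F q) :
    ∃ c : Λ → Λ, ∀ α : ℕ → Λ, StrictMono α → (∀ n, ∀ β < α n, c β < α n) →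
      ∀ g : ℕ → Λ, (∀ n, g n < α n) → ∃ (k : ℕ) (γ : ℕ → Λ), (∀ n, g n ≤ γ n) ∧
        Viol F (pl q γ α k) := by
  classical
  induction hq with
  | viol q hv => exact ⟨id, fun α _ _ g _ => ⟨0, g, fun n => le_rfl, hv⟩⟩
  | step q η ξ _ ih =>
    have hξ' : ∀ γ α, ∃ c : Λ → Λ, η ≤ γ → ξ γ ≤ α → ∀ α' : ℕ → Λ, StrictMono α' →
      (∀ n, ∀ β < α' n, c β < α' n) →
      ∀ g : ℕ → Λ, (∀ n, g n < α' n) → ∃ (k : ℕ) (γ' : ℕ → Λ), (∀ n, g n ≤ γ' n) ∧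
        Viol F (pl ((γ, α) :: q) γ' α' k) := by
      intro γ α
      by_cases h1 : η ≤ γ ∧ ξ γ ≤ α
      · obtain ⟨c, hc⟩ := ih γ α h1.1 h1.2
        exact ⟨c, fun _ _ => hc⟩
      · exact ⟨id, fun h2 h3 => absurd ⟨h2, h3⟩ h1⟩
    choose C hC using hξ'
    have hc : ∀ β : Λ, ∃ d, η < d ∧ (∀ γ ≤ β, ξ γ < d) ∧
        ∀ γ ≤ β, ∀ α ≤ β, ∀ β' ≤ β, C γ α β' < d := by
      intro β
      obtain ⟨d1, hd1⟩ := h.hB (Set.Iic β) (fun x => ξ x.1) (h.hI β)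
      obtain ⟨d2, hd2⟩ := h.hB (Set.Iic β × Set.Iic β × Set.Iic β)
        (fun x => C x.1.1 x.2.1.1 x.2.2.1) (by
          simp only [Cardinal.mk_prod, Cardinal.lift_id]
          calc _ ≤ 𝔠 * (𝔠 * 𝔠) := by gcongr <;> exact h.hI β
            _ = 𝔠 := by simp)
      obtain ⟨d3, h31, h32⟩ := h.two d1 d2
      obtain ⟨d4, h41, h42⟩ := h.two d3 η
      exact ⟨d4, h42, fun γ hγ => (hd1 ⟨γ, hγ⟩).trans (h31.trans h41), fun γ hγ α hα β' hβ' =>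
        (hd2 (⟨γ, hγ⟩, ⟨α, hα⟩, ⟨β', hβ'⟩)).trans (h32.trans h41)⟩
    choose c hc1 hc2 hc3 using hc
    refine ⟨c, fun α hα hcl g hg => ?_⟩
    let γ0 := max η (g 0)
    have hη : η < α 0 := (hc1 (g 0)).trans (hcl 0 _ (hg 0))
    have hγ0 : γ0 < α 0 := max_lt hη (hg 0)
    have hξ0 : ξ γ0 < α 0 := (hc2 γ0 γ0 le_rfl).trans (hcl 0 _ hγ0)
    obtain ⟨k, γ', hγ', hv⟩ := hC γ0 (α 0) (le_max_left _ _) hξ0.le (fun n => α (n + 1))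
      (fun a b hab => hα (by simpa using hab)) (by
        intro n β hβ
        have h0 : α 0 < α (n + 1) := hα (Nat.succ_pos n)
        have hm : max β (α 0) < α (n + 1) := max_lt hβ h0
        refine (hc3 (max β (α 0)) γ0 (hγ0.le.trans (le_max_right _ _)) (α 0) (le_max_right _ _)
          β (le_max_left _ _)).trans (hcl _ _ hm)) (fun n => g (n + 1)) (fun n => hg _)
    refine ⟨k + 1, fun n => Nat.casesOn n γ0 γ', ?_, ?_⟩
    · intro n
      cases n with
      | zero => exact le_max_right _ _
      | succ n => exact hγ' n
    · rw [pl_shift]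
      exact hv

lemma not_bad_nil (h : Reg Λ) (F : List Λ → Set Λ) (hF : ∀ l, (F l).Countable) : ¬ Bad F [] := by
  classical
  intro hb
  obtain ⟨c, hc⟩ := bad_aux h F [] hb
  choose nx h1 h2 h3 using h.closedPt c
  obtain ⟨b0, -⟩ := h.countable (s := ∅) (by simp)
  let α : ℕ → Λ := fun n => Nat.rec (nx b0) (fun _ a => nx a) n
  have hα : StrictMono α := strictMono_nat_of_lt_succ (fun n => h1 (α n))
  have hex : ∀ n, ∃ b, α n = nx b := by
    intro n
    cases n with
    | zero => exact ⟨b0, rfl⟩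
    | succ n => exact ⟨α n, rfl⟩
  let X : Set Λ := ⋃ k, F ((pl [] α α k).map Prod.snd)
  have hX : X.Countable := Set.countable_iUnion (fun k => hF _)
  have hg : ∀ n, ∃ g < α n, ∀ x ∈ X, x < α n → x < g := by
    intro n
    obtain ⟨b, hb⟩ := hex n
    rw [hb]
    exact h3 b X hX
  choose g hg1 hg2 using hg
  obtain ⟨k, γ, hγ, u, hu, x, hx, hx1, hx2⟩ := hc α hα (fun n => by
    obtain ⟨b, hb⟩ := hex n
    rw [hb]
    exact h2 b) g hg1
  obtain ⟨n, rfl⟩ := mem_pl _ _ _ _ hu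
  rw [pl_snd γ α α k] at hx
  have := hg2 n x (Set.mem_iUnion.2 ⟨k, hx⟩) hx2
  exact absurd ((hγ n).trans hx1) (not_le.2 this)

lemma game (h : Reg Λ) (F : List Λ → Set Λ) (hF : ∀ l, (F l).Countable) :
    ∃ G : Set (List (Λ × Λ)), [] ∈ G ∧ ∀ q ∈ G, ¬ Viol F q ∧
      ∀ η, ∃ γ, η ≤ γ ∧ ∀ ξ, ∃ α, ξ ≤ α ∧ (γ, α) :: q ∈ G := by
  refine ⟨{q | ¬ Bad F q}, not_bad_nil h F hF, fun q hq => ⟨fun hv => hq (.viol q hv), ?_⟩⟩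
  intro η
  by_contra hcon
  push Not at hcon
  have hcon' : ∀ γ, ∃ ξ, η ≤ γ → ∀ α, ξ ≤ α → Bad F ((γ, α) :: q) := by
    intro γ
    by_cases hγ : η ≤ γ
    · obtain ⟨ξ, hξ⟩ := hcon γ hγ
      exact ⟨ξ, fun _ α hα => by simpa using hξ α hα⟩
    · exact ⟨η, fun h => absurd h hγ⟩
  choose ξ hξ using hcon'
  exact hq (.step q η ξ fun γ α hγ hα => hξ γ hγ α hα)

lemma tree (h : Reg Λ) (F : List Λ → Set Λ) (hF : ∀ l, (F l).Countable)
    (hF2 : ∀ a l, a ∈ F (a :: l)) :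
    ∃ i : ℕ → Λ, StrictMono i ∧ ∀ r : ℕ → Bool, ∃ l : ℕ → List Λ,
      (∀ n, l (n + 1) = l n ∨ ∃ a, l (n + 1) = a :: l n) ∧
      (∀ n, r n = true → ∃ m, ∃ x ∈ F (l m), i n < x ∧ x ≤ i (n + 1)) ∧
      (∀ n, r n = false → ∀ m, ∀ x ∈ F (l m), i n < x → ¬ x ≤ i (n + 1)) ∧
      (∀ m, ∀ x ∈ F (l m), ∃ n, x ≤ i n) := by
  classical
  obtain ⟨G, hG0, hG⟩ := game h F hF
  let St := {s : List (Λ × Λ) × Λ // s.1 ∈ G ∧ (∀ x ∈ F (s.1.map Prod.snd), x < s.2) ∧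
    ∀ ξ, ∃ α, ξ ≤ α ∧ (s.2, α) :: s.1 ∈ G}
  have hmk : ∀ q ∈ G, ∃ s : St, s.1.1 = q := by
    intro q hq
    obtain ⟨b, hb⟩ := h.countable (hF (q.map Prod.snd))
    obtain ⟨γ, hγ, hγ2⟩ := (hG q hq).2 b
    exact ⟨⟨(q, γ), hq, fun x hx => (hb x hx).trans_le hγ, hγ2⟩, rfl⟩
  have hstep : ∀ (s : St) (i : Λ), ∃ s' : St, ∃ α, i < α ∧ s'.1.1 = (s.1.2, α) :: s.1.1 := by
    intro s i
    obtain ⟨j, hj, -⟩ := h.two i i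
    obtain ⟨α, hα, hα2⟩ := s.2.2.2 j
    obtain ⟨s', hs'⟩ := hmk _ hα2
    exact ⟨s', α, hj.trans_le hα, hs'⟩
  choose nx A hA hnx using hstep
  have hsup : ∀ (f : (ℕ → Bool) → St) (i : Λ), ∃ j, i < j ∧ ∀ r, (f r).1.2 < j := by
    intro f i
    obtain ⟨d, hd⟩ := h.hB (ℕ → Bool) (fun r => (f r).1.2) (by simp)
    obtain ⟨e, he1, he2⟩ := h.two i d
    exact ⟨e, he1, fun r => (hd r).trans he2⟩
  choose J hJ1 hJ2 using hsup
  obtain ⟨s0, -⟩ := hmk [] hG0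
  let upd : ((ℕ → Bool) → St) × Λ → ℕ → (ℕ → Bool) → St := fun P n r =>
    if r n = true then nx (P.1 r) P.2 else P.1 r
  let T : ℕ → ((ℕ → Bool) → St) × Λ := fun n => Nat.rec (fun _ => s0, J (fun _ => s0) s0.1.2)
    (fun n P => (upd P n, J (upd P n) P.2)) n
  have hT : ∀ n, T (n + 1) = (upd (T n) n, J (upd (T n) n) (T n).2) := fun n => rfl
  let i : ℕ → Λ := fun n => (T n).2
  let st : ℕ → (ℕ → Bool) → St := fun n => (T n).1
  have hi : StrictMono i := strictMono_nat_of_lt_succ (fun n => by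
    simp only [i, hT]; exact hJ1 _ _)
  have hst : ∀ n r, st (n + 1) r = if r n = true then nx (st n r) (i n) else st n r :=
    fun n r => rfl
  have hγ : ∀ n r, (st n r).1.2 < i n := by
    intro n r
    cases n with
    | zero => exact hJ2 (fun _ => s0) s0.1.2 r
    | succ n => exact hJ2 (upd (T n) n) (T n).2 r
  refine ⟨i, hi, fun r => ⟨fun n => (st n r).1.1.map Prod.snd, ?_, ?_, ?_, ?_⟩⟩
  · intro n
    by_cases hr : r n = true
    · right
      refine ⟨A (st n r) (i n), ?_⟩
      simp only [hst, hr, if_true, hnx, List.map_cons]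
    · left
      simp only [hst, if_neg hr]
  · intro n hr
    have e : (st (n + 1) r).1.1 = ((st n r).1.2, A (st n r) (i n)) :: (st n r).1.1 := by
      rw [hst, if_pos hr, hnx]
    have hmem : A (st n r) (i n) ∈ F ((st (n + 1) r).1.1.map Prod.snd) := by
      rw [e]; exact hF2 _ _
    exact ⟨n + 1, _, hmem, hA _ _, ((st (n + 1) r).2.2.1 _ hmem).le.trans (hγ (n + 1) r).le⟩
  · intro n hr m x hx h1 h2
    have hs : st (n + 1) r = st n r := by rw [hst, if_neg (by simp [hr])]
    have key : ∀ d, st (n + 1 + d) r = st n r ∨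
        ∃ α, i (n + 1) < α ∧ ((st n r).1.2, α) ∈ (st (n + 1 + d) r).1.1 := by
      intro d
      induction d with
      | zero => exact Or.inl hs
      | succ d ih =>
        rw [← add_assoc]
        by_cases hr' : r (n + 1 + d) = true
        · have e : (st (n + 1 + d + 1) r).1.1 = ((st (n + 1 + d) r).1.2,
              A (st (n + 1 + d) r) (i (n + 1 + d))) :: (st (n + 1 + d) r).1.1 := by
            rw [hst, if_pos hr', hnx]
          right
          rw [e]
          rcases ih with ih | ⟨α, hα, hm⟩
          · rw [ih]
            have h5 : i (n + 1) ≤ i (n + 1 + d) := hi.monotone (show n + 1 ≤ n + 1 + d by omega)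
            exact ⟨_, h5.trans_lt (hA (st n r) (i (n + 1 + d))), List.mem_cons_self ..⟩
          · exact ⟨α, hα, List.mem_cons_of_mem _ hm⟩
        · have : st (n + 1 + d + 1) r = st (n + 1 + d) r := by rw [hst, if_neg hr']
          rw [this]; exact ih
    rcases Nat.lt_or_ge n m with hnm | hnm
    · obtain ⟨d, rfl⟩ := Nat.exists_eq_add_of_le hnm
      rcases key d with hk | ⟨α, hα, hm⟩
      · have h3 : x < (st n r).1.2 := by
          have := (st (n + 1 + d) r).2.2.1 x hx
          rwa [hk] at this
        exact absurd (h3.trans (hγ n r)) (not_lt.2 h1.le)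
      · refine (hG _ (st (n + 1 + d) r).2.1).1 ⟨_, hm, x, hx, ?_, h2.trans_lt hα⟩
        exact (hγ n r).le.trans h1.le
    · have h3 := (st m r).2.2.1 x hx
      have h4 := (h3.trans (hγ m r)).trans_le (hi.monotone hnm)
      exact absurd h4 (not_lt.2 h1.le)
  · intro m x hx
    exact ⟨m, ((st m r).2.2.1 x hx).le.trans (hγ m r).le⟩

end Lam

/-- A weak form of the Erdős–Rado theorem for linear orders. -/
lemma erdos_rado {U Λ : Type} [LinearOrder U] [LinearOrder Λ] [WellFoundedLT Λ]
    (h : #(Λ → Ordering) < #U) : ∃ (x : U) (p : Λ → U), (∀ ξ, p ξ ≠ x) ∧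
      (∀ ζ ξ, ζ < ξ → p ζ < x → p ζ < p ξ) ∧ (∀ ζ ξ, ζ < ξ → x < p ζ → p ξ < p ζ) := by
  classical
  have wf : WellFounded (WellOrderingRel (α := U)) := WellOrderingRel.isWellOrder.wf
  have ne : ∀ (x : U) (ξ : Λ) (g : ∀ ζ, ζ < ξ → U),
      {y : U | ∀ ζ (hζ : ζ < ξ), cmp (g ζ hζ) y = cmp (g ζ hζ) x}.Nonempty :=
    fun x ξ g => ⟨x, fun _ _ => rfl⟩
  let p : U → Λ → U := fun x => (wellFounded_lt (α := Λ)).fix (fun ξ g => wf.min _ (ne x ξ g))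
  have hp : ∀ x ξ, p x ξ = wf.min _ (ne x ξ (fun ζ _ => p x ζ)) := fun x ξ =>
    WellFounded.fix_eq _ _ _
  have hp2 : ∀ x ξ ζ, ζ < ξ → cmp (p x ζ) (p x ξ) = cmp (p x ζ) x := by
    intro x ξ ζ hζ
    have := wf.min_mem _ (ne x ξ (fun ζ _ => p x ζ))
    rw [← hp] at this
    exact this ζ hζ
  by_contra hcon
  have hends : ∀ x, ∃ ξ, p x ξ = x := by
    intro x
    by_contra hx
    push Not at hx
    refine hcon ⟨x, p x, hx, fun ζ ξ hζ hl => ?_, fun ζ ξ hζ hl => ?_⟩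
    · have := hp2 x ξ ζ hζ
      rw [(cmp_eq_lt_iff _ _).2 hl] at this
      exact (cmp_eq_lt_iff _ _).1 this
    · have := hp2 x ξ ζ hζ
      rw [(cmp_eq_gt_iff _ _).2 hl] at this
      exact (cmp_eq_gt_iff _ _).1 this
  refine absurd h (not_lt.2 (Cardinal.mk_le_of_injective
    (f := fun (x : U) (ξ : Λ) => cmp (p x ξ) x) ?_))
  intro x y hxy
  have hk : ∀ ξ, cmp (p x ξ) x = cmp (p y ξ) y := fun ξ => congrFun hxy ξ
  have hpe : ∀ ξ, p x ξ = p y ξ := by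
    intro ξ
    induction ξ using (wellFounded_lt (α := Λ)).induction with
    | _ ξ ih =>
      rw [hp, hp]
      congr 1
      ext z
      refine forall_congr' fun ζ => forall_congr' fun hζ => ?_
      rw [hk ζ, ih ζ hζ]
  obtain ⟨ξ, hξ⟩ := hends x
  have h1 : cmp (p x ξ) x = .eq := by rw [hξ]; exact cmp_self_eq_eq x
  rw [hk ξ] at h1
  rw [← hξ, hpe ξ]
  exact (cmp_eq_eq_iff _ _).1 h1

/-! ### Coding countable sets -/

/-- The axioms saying that `E` codes enough sets of elements of the linear order `R`. -/
structure Ax {N : Type} (R E : N → N → Prop) (G : N → N → N → N → N) : Prop where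
  r1 : ∀ x y, R x y → R x x
  r2 : ∀ x y, R x y → R y y
  tr : ∀ x y z, R x y → R y z → R x z
  asy : ∀ x y, R x y → R y x → x = y
  tot : ∀ x y, R x x → R y y → R x y ∨ R y x
  eu : ∀ u p, E u p → R u u
  cut : ∀ p a b, ∃ p', ∀ x, E x p' ↔ E x p ∧ ¬ R x a ∧ ¬ R b x
  surj : ∀ p q w, (∃ x, E x p) → (∀ x, E x p → ∃ y, E y q ∧ ¬ R y x) →
    (∀ y, E y q → ∃ x, E x p ∧ ¬ R x y) → ∀ z, E z w → ∃ x, E x p ∧ G p q w x = z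
  cst : ∀ p q w x x', E x p → E x' p → R x x' → (¬ ∃ y, E y q ∧ R x y ∧ R y x') →
    G p q w x = G p q w x'
  comp : ∀ p q w v, ∃ r, ∀ z, E z r ↔ (E z w ∧ ∃ x, E x p ∧ G p q w x = z ∧
    ∃ y, E y v ∧ R x y ∧ ¬ ∃ u, E u q ∧ R x u ∧ R u y)

lemma pattern {N : Type} {R E : N → N → Prop} {G : N → N → N → N → N} (ax : Ax R E G)
    {C : Set (Set N)} (hC : IsClubFam C) {Λ : Type} [LinearOrder Λ] [WellFoundedLT Λ]
    (hΛ : Reg Λ) (a : Λ → N) (ha : ∀ ζ ξ, ζ < ξ → R (a ζ) (a ξ) ∧ ¬ R (a ξ) (a ζ)) :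
    ∃ i : ℕ → Λ, StrictMono i ∧ ∀ r : ℕ → Bool, ∃ W ∈ C,
      (∀ n, r n = true → ∃ x ∈ W, ¬ R x (a (i n)) ∧ R x (a (i (n + 1)))) ∧
      (∀ n, r n = false → ∀ x ∈ W, ¬ R x (a (i n)) → ¬ R x (a (i (n + 1)))) ∧
      ∀ x ∈ W, ∀ ξ, R x (a ξ) → ∃ n, R x (a (i n)) := by
  classical
  have haU : ∀ ξ, R (a ξ) (a ξ) := by
    intro ξ
    obtain ⟨b, hb, -⟩ := hΛ.two ξ ξ
    exact ax.r1 _ _ (ha _ _ hb).1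
  have mono : ∀ ζ ξ, ζ ≤ ξ → R (a ζ) (a ξ) := by
    intro ζ ξ h
    rcases h.lt_or_eq with h | rfl
    · exact (ha _ _ h).1
    · exact haU _
  have hg : ∀ X : Set N, ∃ T : Set N, X.Countable → T ∈ C ∧ X ⊆ T := by
    intro X
    by_cases hX : X.Countable
    · obtain ⟨T, h1, h2⟩ := hC.2.2 X hX
      exact ⟨T, fun _ => ⟨h1, h2⟩⟩
    · exact ⟨∅, fun h => absurd h hX⟩
  choose g hg using hg
  let Fn : List N → Set N := fun l => List.rec (g ∅) (fun x _ T => g (insert x T)) l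
  have Fn1 : ∀ x l, Fn (x :: l) = g (insert x (Fn l)) := fun x l => rfl
  have FnC : ∀ l, Fn l ∈ C := by
    intro l
    induction l with
    | nil => exact (hg ∅ (by simp)).1
    | cons x l ih =>
      rw [Fn1]
      exact (hg _ ((hC.1 _ ih).insert x)).1
  have Fn2 : ∀ x l, insert x (Fn l) ⊆ Fn (x :: l) := by
    intro x l
    rw [Fn1]
    exact (hg _ ((hC.1 _ (FnC l)).insert x)).2
  have hρ : ∀ x, ∃ ρ, ∀ ξ, R x (a ξ) → R x (a ρ) ∧ ρ ≤ ξ := by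
    intro x
    by_cases hx : {ξ | R x (a ξ)}.Nonempty
    · refine ⟨(wellFounded_lt (α := Λ)).min _ hx, fun ξ hξ => ⟨?_, ?_⟩⟩
      · exact (wellFounded_lt (α := Λ)).min_mem _ hx
      · exact not_lt.1 ((wellFounded_lt (α := Λ)).not_lt_min {ξ | R x (a ξ)} (x := ξ) hξ)
    · obtain ⟨b, -⟩ := hΛ.countable (s := ∅) (by simp)
      exact ⟨b, fun ξ hξ => absurd ⟨ξ, hξ⟩ hx⟩
  choose ρ hρ using hρ
  have hρ' : ∀ x, (∃ ξ, R x (a ξ)) → ∀ ξ, ρ x ≤ ξ ↔ R x (a ξ) := by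
    rintro x ⟨ξ0, h0⟩ ξ
    exact ⟨fun h => ax.tr _ _ _ (hρ x ξ0 h0).1 (mono _ _ h), fun h => (hρ x ξ h).2⟩
  have hρa : ∀ ξ, ρ (a ξ) = ξ := by
    intro ξ
    have h1 := hρ (a ξ) ξ (haU ξ)
    rcases h1.2.lt_or_eq with h | h
    · exact absurd h1.1 (ha _ _ h).2
    · exact h
  obtain ⟨i, hi, H⟩ := tree hΛ (fun l => ρ '' {x ∈ Fn (l.map a) | ∃ ξ, R x (a ξ)})
    (fun l => (((hC.1 _ (FnC _))).mono (fun x hx => hx.1)).image ρ)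
    (fun ξ l => ⟨a ξ, ⟨Fn2 _ _ (Set.mem_insert _ _), ξ, haU ξ⟩, hρa ξ⟩)
  refine ⟨i, hi, fun r => ?_⟩
  obtain ⟨l, hl, H1, H2, H3⟩ := H r
  refine ⟨⋃ n, Fn ((l n).map a), ?_, ?_, ?_, ?_⟩
  · refine hC.2.1 _ (fun n => FnC _) (monotone_nat_of_le_succ fun n => ?_)
    rcases hl n with h | ⟨b, h⟩
    · rw [h]
    · rw [h]
      exact (Set.subset_insert _ _).trans (Fn2 _ _)
  · intro n hn
    obtain ⟨m, _, ⟨x, ⟨hx, hx2⟩, rfl⟩, h1, h2⟩ := H1 n hn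
    refine ⟨x, Set.mem_iUnion.2 ⟨m, hx⟩, ?_, (hρ' x hx2 _).1 h2⟩
    rw [← hρ' x hx2]
    exact not_le.2 h1
  · intro n hn x hx h1 h2
    obtain ⟨m, hm⟩ := Set.mem_iUnion.1 hx
    have hx2 : ∃ ξ, R x (a ξ) := ⟨_, h2⟩
    rw [← hρ' x hx2] at h1 h2
    exact H2 n hn m _ ⟨x, ⟨hm, hx2⟩, rfl⟩ (not_le.1 h1) h2
  · intro x hx ξ hξ
    obtain ⟨m, hm⟩ := Set.mem_iUnion.1 hx
    obtain ⟨n, hn⟩ := H3 m _ ⟨x, ⟨hm, ξ, hξ⟩, rfl⟩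
    exact ⟨n, (hρ' x ⟨ξ, hξ⟩ _).1 hn⟩

lemma code_of_ax {N : Type} {R E : N → N → Prop} {G : N → N → N → N → N} (ax : Ax R E G)
    {C : Set (Set N)} (hC : IsClubFam C) (hco : ∀ X ∈ C, ∃ p, ∀ u, E u p ↔ u ∈ X ∧ R u u)
    {Λ : Type} [LinearOrder Λ] [WellFoundedLT Λ]
    (hΛ : Reg Λ) (a : Λ → N) (ha : ∀ ζ ξ, ζ < ξ → R (a ζ) (a ξ) ∧ ¬ R (a ξ) (a ζ))
    (S : Set N) (hS : S.Countable) (hSU : ∀ x ∈ S, R x x) : ∃ p, ∀ u, E u p ↔ u ∈ S := by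
  classical
  obtain ⟨i, hi, H⟩ := pattern ax hC hΛ a ha
  have haU : ∀ ξ, R (a ξ) (a ξ) := by
    intro ξ
    obtain ⟨b, hb, -⟩ := hΛ.two ξ ξ
    exact ax.r1 _ _ (ha _ _ hb).1
  have mono : ∀ ζ ξ, ζ ≤ ξ → R (a ζ) (a ξ) := by
    intro ζ ξ h
    rcases h.lt_or_eq with h | rfl
    · exact (ha _ _ h).1
    · exact haU _
  have ntr : ∀ x y z, R x x → R y y → R z z → ¬ R x y → R z y → ¬ R x z :=
    fun x y z _ _ _ h1 h2 h3 => h1 (ax.tr _ _ _ h3 h2)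
  let A : ℕ → N := fun n => a (i n)
  have AU : ∀ n, R (A n) (A n) := fun n => haU _
  have Am : ∀ m n, m ≤ n → R (A m) (A n) := fun m n h => mono _ _ (hi.monotone h)
  -- position of an element below the supremum
  have pos : ∀ x, R x x → ¬ R x (A 0) → (∃ n, R x (A n)) → ∃ n, ¬ R x (A n) ∧ R x (A (n + 1)) := by
    intro x hx h0 hn
    have h1 := Nat.find_spec hn
    have h2 : Nat.find hn ≠ 0 := fun h => h0 (by rw [h] at h1; exact h1)
    obtain ⟨k, hk⟩ := Nat.exists_eq_succ_of_ne_zero h2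
    refine ⟨k, Nat.find_min hn (by omega), ?_⟩
    rw [hk] at h1
    exact h1
  obtain ⟨ξs, hξs⟩ := hΛ.countable (s := Set.range i) (Set.countable_range i)
  let b := a ξs
  have hAb : ∀ n, R (A n) b ∧ ¬ R b (A n) := fun n => ha _ _ (hξs _ ⟨n, rfl⟩)
  obtain ⟨Z, hZ, hSZ⟩ := hC.2.2 S hS
  obtain ⟨w, hw⟩ := hco Z hZ
  obtain ⟨X, hX, X1, X2, X3⟩ := H (fun n => decide (n % 3 = 0))
  obtain ⟨Y, hY, Y1, Y2, Y3⟩ := H (fun n => decide (n % 3 = 2))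
  obtain ⟨p0, hp0⟩ := hco X hX
  obtain ⟨q0, hq0⟩ := hco Y hY
  obtain ⟨p, hp⟩ := ax.cut p0 (A 0) b
  obtain ⟨q, hq⟩ := ax.cut q0 (A 0) b
  have lt_of : ∀ x, R x x → ¬ R b x → R x b := fun x hx h =>
    (ax.tot x b hx (haU _)).resolve_right h
  have nb : ∀ x n, R x (A n) → ¬ R b x := fun x n h h2 => (hAb n).2 (ax.tr _ _ _ h2 h)
  -- elements of p
  have pE : ∀ x, E x p ↔ x ∈ X ∧ R x x ∧ ∃ k, ¬ R x (A (3 * k)) ∧ R x (A (3 * k + 1)) := by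
    intro x
    rw [hp, hp0]
    constructor
    · rintro ⟨⟨h1, h2⟩, h3, h4⟩
      refine ⟨h1, h2, ?_⟩
      obtain ⟨n, hn⟩ := X3 x h1 ξs (lt_of x h2 h4)
      obtain ⟨m, hm1, hm2⟩ := pos x h2 h3 ⟨n, hn⟩
      have : m % 3 = 0 := by
        by_contra hne
        exact X2 m (by simpa using hne) x h1 hm1 hm2
      exact ⟨m / 3, by rwa [show 3 * (m / 3) = m by omega], by rwa [show 3 * (m / 3) = m by omega]⟩
    · rintro ⟨h1, h2, k, h3, h4⟩
      exact ⟨⟨h1, h2⟩, fun h => h3 (ax.tr _ _ _ h (Am _ _ (by omega))), nb _ _ h4⟩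
  have qE : ∀ x, E x q ↔ x ∈ Y ∧ R x x ∧ ∃ k, ¬ R x (A (3 * k + 2)) ∧ R x (A (3 * k + 3)) := by
    intro x
    rw [hq, hq0]
    constructor
    · rintro ⟨⟨h1, h2⟩, h3, h4⟩
      refine ⟨h1, h2, ?_⟩
      obtain ⟨n, hn⟩ := Y3 x h1 ξs (lt_of x h2 h4)
      obtain ⟨m, hm1, hm2⟩ := pos x h2 h3 ⟨n, hn⟩
      have : m % 3 = 2 := by
        by_contra hne
        exact Y2 m (by simpa using hne) x h1 hm1 hm2
      exact ⟨m / 3, by rwa [show 3 * (m / 3) + 2 = m by omega],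
        by rwa [show 3 * (m / 3) + 3 = m + 1 by omega]⟩
    · rintro ⟨h1, h2, k, h3, h4⟩
      exact ⟨⟨h1, h2⟩, fun h => h3 (ax.tr _ _ _ h (Am _ _ (by omega))), nb _ _ h4⟩
  have pex : ∀ k, ∃ x, E x p ∧ ¬ R x (A (3 * k)) ∧ R x (A (3 * k + 1)) := by
    intro k
    obtain ⟨x, h1, h2, h3⟩ := X1 (3 * k) (by simp)
    exact ⟨x, (pE x).2 ⟨h1, ax.r1 _ _ h3, k, h2, h3⟩, h2, h3⟩
  have qex : ∀ k, ∃ x, E x q ∧ ¬ R x (A (3 * k + 2)) ∧ R x (A (3 * k + 3)) := by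
    intro k
    obtain ⟨x, h1, h2, h3⟩ := Y1 (3 * k + 2) (by simp)
    exact ⟨x, (qE x).2 ⟨h1, ax.r1 _ _ h3, k, h2, h3⟩, h2, h3⟩
  have EU : ∀ u p, E u p → R u u := ax.eu
  -- comparing positions
  have ple : ∀ x y m, R y y → R x (A m) → ¬ R y (A m) → R x y ∧ ¬ R y x := by
    intro x y m hy h1 h2
    have h3 : R (A m) y := (ax.tot _ _ hy (AU m)).resolve_left h2
    exact ⟨ax.tr _ _ _ h1 h3, fun h => h2 (ax.tr _ _ _ h h1)⟩
  have sj := ax.surj p q w ⟨_, (pex 0).choose_spec.1⟩ (by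
    intro x hx
    obtain ⟨_, _, k, _, h⟩ := (pE x).1 hx
    obtain ⟨y, hy, h1, h2⟩ := qex k
    refine ⟨y, hy, (ple x y (3 * k + 2) (EU _ _ hy) (ax.tr _ _ _ h (Am _ _ (by omega))) h1).2⟩) (by
    intro y hy
    obtain ⟨_, _, k, _, h⟩ := (qE y).1 hy
    obtain ⟨x, hx, h1, h2⟩ := pex (k + 1)
    exact ⟨x, hx, (ple y x (3 * (k + 1)) (EU _ _ hx) h h1).2⟩)
  obtain ⟨V, hV, V1, V2, V3⟩ := H (fun n => decide (n % 3 = 1 ∧ ∃ x, E x p ∧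
    ¬ R x (A (3 * (n / 3))) ∧ R x (A (3 * (n / 3) + 1)) ∧ G p q w x ∈ S))
  obtain ⟨v, hv⟩ := hco V hV
  obtain ⟨r, hr⟩ := ax.comp p q w v
  refine ⟨r, fun z => ?_⟩
  rw [hr]
  constructor
  · rintro ⟨hz, x, hx, rfl, y, hy, hxy, hno⟩
    obtain ⟨hxX, hxU, k, hk1, hk2⟩ := (pE x).1 hx
    obtain ⟨hyV, hyU⟩ := (hv y).1 hy
    obtain ⟨u, hu, hu1, hu2⟩ := qex k
    have huU := EU _ _ hu
    have hxu : R x u := (ple x u (3 * k + 2) huU (ax.tr _ _ _ hk2 (Am _ _ (by omega))) hu1).1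
    have huy : ¬ R u y := fun h => hno ⟨u, hu, hxu, h⟩
    have hyu : R y u := (ax.tot _ _ hyU huU).resolve_right huy
    have hyA : R y (A (3 * k + 3)) := ax.tr _ _ _ hyu hu2
    have hy0 : ∀ m, m ≤ 3 * k → ¬ R y (A m) := fun m hm h =>
      hk1 (ax.tr _ _ _ (ax.tr _ _ _ hxy h) (Am _ _ hm))
    obtain ⟨m, hm1, hm2⟩ := pos y hyU (hy0 0 (by omega)) ⟨_, hyA⟩
    have hm3 : 3 * k ≤ m := by
      by_contra hlt
      exact hy0 (m + 1) (by omega) hm2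
    have hm4 : m < 3 * k + 3 := by
      by_contra hlt
      exact hm1 (ax.tr _ _ _ hyA (Am _ _ (by omega)))
    have hm5 : m % 3 = 1 ∧ ∃ x, E x p ∧
        ¬ R x (A (3 * (m / 3))) ∧ R x (A (3 * (m / 3) + 1)) ∧ G p q w x ∈ S := by
      by_contra hne
      exact V2 m (by simpa using hne) y hyV hm1 hm2
    obtain ⟨_, x', hx', h1, h2, h3⟩ := hm5
    rw [show m / 3 = k by omega] at h1 h2
    have nog : ∀ s t, R s s → ¬ R s (A (3 * k)) → R t (A (3 * k + 1)) →
        ¬ ∃ y, E y q ∧ R s y ∧ R y t := by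
      rintro s t hs hs1 ht ⟨y', hy', hy1, hy2⟩
      obtain ⟨_, _, j, hj1, hj2⟩ := (qE y').1 hy'
      have e1 : R y' (A (3 * k + 1)) := ax.tr _ _ _ hy2 ht
      have e2 : j < k := by
        by_contra hlt
        exact hj1 (ax.tr _ _ _ e1 (Am _ _ (by omega)))
      exact hs1 (ax.tr _ _ _ hy1 (ax.tr _ _ _ hj2 (Am _ _ (by omega))))
    rcases ax.tot x x' hxU (EU _ _ hx') with h | h
    · rw [ax.cst p q w x x' hx hx' h (nog _ _ hxU hk1 h2)]
      exact h3
    · rw [← ax.cst p q w x' x hx' hx h (nog _ _ (EU _ _ hx') h1 hk2)]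
      exact h3
  · intro hz
    have hzw : E z w := (hw z).2 ⟨hSZ hz, hSU z hz⟩
    obtain ⟨x, hx, hxz⟩ := sj z hzw
    obtain ⟨hxX, hxU, k, hk1, hk2⟩ := (pE x).1 hx
    obtain ⟨y, hyV, hy1, hy2⟩ := V1 (3 * k + 1) (by
      simp only [decide_eq_true_eq]
      refine ⟨by omega, x, hx, ?_, ?_, hxz ▸ hz⟩
      · rwa [show (3 * k + 1) / 3 = k by omega]
      · rwa [show (3 * k + 1) / 3 = k by omega])
    have hyU := ax.r1 _ _ hy2
    refine ⟨hzw, x, hx, hxz, y, (hv y).2 ⟨hyV, hyU⟩, (ple x y _ hyU hk2 hy1).1, ?_⟩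
    rintro ⟨u, hu, hu1, hu2⟩
    obtain ⟨_, _, j, hj1, hj2⟩ := (qE u).1 hu
    have e1 : R u (A (3 * k + 2)) := ax.tr _ _ _ hu2 hy2
    have e2 : j < k := by
      by_contra hlt
      exact hj1 (ax.tr _ _ _ e1 (Am _ _ (by omega)))
    exact hk1 (ax.tr _ _ _ hu1 (ax.tr _ _ _ hj2 (Am _ _ (by omega))))

/-- The bound on the size of fake models. -/
noncomputable def bigCard : Cardinal.{0} := #((Order.succ 𝔠).ord.ToType → Ordering)

lemma code_all {N : Type} {R E : N → N → Prop} {G G' : N → N → N → N → N} (ax : Ax R E G)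
    (ax' : Ax (fun x y => R y x) E G')
    {C : Set (Set N)} (hC : IsClubFam C) (hco : ∀ X ∈ C, ∃ p, ∀ u, E u p ↔ u ∈ X ∧ R u u)
    (hU : bigCard < #{x // R x x})
    (S : Set N) (hS : S.Countable) (hSU : ∀ x ∈ S, R x x) : ∃ p, ∀ u, E u p ↔ u ∈ S := by
  classical
  letI : LinearOrder {x // R x x} :=
    { le := fun x y => R x.1 y.1
      le_refl := fun x => x.2
      le_trans := fun x y z => ax.tr _ _ _
      le_antisymm := fun x y h1 h2 => Subtype.ext (ax.asy _ _ h1 h2)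
      le_total := fun x y => ax.tot _ _ x.2 y.2
      toDecidableLE := Classical.decRel _ }
  obtain ⟨x, p, h1, h2, h3⟩ := erdos_rado (U := {x // R x x}) hU
  by_cases hT : ∀ b, ∃ t ∈ {ξ | p ξ < x}, b < t
  · refine code_of_ax ax hC hco (reg_toType.sub _ hT) (fun t => (p t.1).1) ?_ S hS hSU
    intro ζ ξ h
    have := h2 ζ.1 ξ.1 h ζ.2
    exact ⟨this.le, this.not_ge⟩
  · push Not at hT
    obtain ⟨b, hb⟩ := hT
    have hT' : ∀ c, ∃ t ∈ {ξ | x < p ξ}, c < t := by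
      intro c
      obtain ⟨d, hd1, hd2⟩ := reg_toType.two b c
      refine ⟨d, ?_, hd2⟩
      by_contra hn
      exact absurd hd1 (not_lt.2 (hb d (lt_of_le_of_ne (not_lt.1 hn) (h1 d))))
    refine code_of_ax ax' hC hco (reg_toType.sub _ hT') (fun t => (p t.1).1) ?_ S hS hSU
    intro ζ ξ h
    have := h3 ζ.1 ξ.1 h ζ.2
    exact ⟨this.le, this.not_ge⟩

/-! ### The extended language and its axioms -/

/-- Extra function symbols. -/
inductive XF : ℕ → Type
  | pi : XF 1
  | g : Bool → XF 4

/-- Extra relation symbols. -/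
inductive XR : ℕ → Type
  | le : XR 2
  | ee : XR 2

/-- The extra vocabulary. -/
def XL : FirstOrder.Language.{0,0} := ⟨XF, XR⟩

/-- The extended vocabulary. -/
abbrev LX (L : FirstOrder.Language.{0,0}) : FirstOrder.Language.{0,0} := L.sum XL

section Comb

variable {M : Type} [L.Structure M] (va : ℕ → M) (vs : ℕ → Set M) (vr : ℕ → M → M → Prop)

/-- Binary conjunction. -/
def fand (φ ψ : Fml L) : Fml L := .conj Bool (fun b => cond b φ ψ)
/-- Implication. -/
def fimp (φ ψ : Fml L) : Fml L := .not (fand φ (.not ψ))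
/-- Equivalence. -/
def fiff (φ ψ : Fml L) : Fml L := fand (fimp φ ψ) (fimp ψ φ)
/-- Disjunction. -/
def fdis (φ ψ : Fml L) : Fml L := fimp (.not φ) ψ
/-- Existential quantification. -/
def fex (x : ℕ) (φ : Fml L) : Fml L := .not (.all x (.not φ))

@[simp] lemma eval_fand (φ ψ : Fml L) :
    Eval (fand φ ψ) va vs vr ↔ Eval φ va vs vr ∧ Eval ψ va vs vr := by
  simp [fand, Eval, and_comm]
@[simp] lemma eval_not (φ : Fml L) : Eval (.not φ) va vs vr ↔ ¬ Eval φ va vs vr := Iff.rfl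
@[simp] lemma eval_fimp (φ ψ : Fml L) :
    Eval (fimp φ ψ) va vs vr ↔ (Eval φ va vs vr → Eval ψ va vs vr) := by
  simp [fimp]
@[simp] lemma eval_fiff (φ ψ : Fml L) :
    Eval (fiff φ ψ) va vs vr ↔ (Eval φ va vs vr ↔ Eval ψ va vs vr) := by
  simp [fiff, iff_iff_implies_and_implies]
@[simp] lemma eval_fdis (φ ψ : Fml L) :
    Eval (fdis φ ψ) va vs vr ↔ (Eval φ va vs vr ∨ Eval ψ va vs vr) := by
  simp [fdis, or_iff_not_imp_left]
@[simp] lemma eval_all (x : ℕ) (φ : Fml L) :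
    Eval (.all x φ) va vs vr ↔ ∀ a, Eval φ (Function.update va x a) vs vr := Iff.rfl
@[simp] lemma eval_fex (x : ℕ) (φ : Fml L) :
    Eval (fex x φ) va vs vr ↔ ∃ a, Eval φ (Function.update va x a) vs vr := by
  simp [fex]
@[simp] lemma eval_eq (s t : L.Term ℕ) :
    Eval (.eq s t) va vs vr ↔ s.realize va = t.realize va := Iff.rfl
@[simp] lemma eval_mem (X : ℕ) (t : L.Term ℕ) :
    Eval (.mem X t) va vs vr ↔ t.realize va ∈ vs X := Iff.rfl
@[simp] lemma eval_aa (X : ℕ) (φ : Fml L) :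
    Eval (.qAA X φ) va vs vr ↔ ∃ C : Set (Set M), IsClubFam C ∧
      ∀ S ∈ C, Eval φ va (Function.update vs X S) vr := Iff.rfl

/-- Being a formula of stationary logic with restricted free variables. -/
def Cl (s t : Set ℕ) (φ : Fml L) : Prop := fv φ ⊆ s ∧ sv φ ⊆ t ∧ rv φ = ∅ ∧ Ok Laa φ

@[simp] lemma cl_fand (s t : Set ℕ) (φ ψ : Fml L) : Cl s t (fand φ ψ) ↔ Cl s t φ ∧ Cl s t ψ := by
  have : #Bool < ℵ₀ := Cardinal.lt_aleph0_of_finite Bool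
  simp [Cl, fand, fv, sv, rv, Ok, Laa]
  tauto
@[simp] lemma cl_not (s t : Set ℕ) (φ : Fml L) : Cl s t (.not φ) ↔ Cl s t φ := Iff.rfl
@[simp] lemma cl_fimp (s t : Set ℕ) (φ ψ : Fml L) : Cl s t (fimp φ ψ) ↔ Cl s t φ ∧ Cl s t ψ := by
  simp [fimp]
@[simp] lemma cl_fiff (s t : Set ℕ) (φ ψ : Fml L) : Cl s t (fiff φ ψ) ↔ Cl s t φ ∧ Cl s t ψ := by
  simp [fiff]; tauto
@[simp] lemma cl_fdis (s t : Set ℕ) (φ ψ : Fml L) : Cl s t (fdis φ ψ) ↔ Cl s t φ ∧ Cl s t ψ := by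
  simp [fdis]
@[simp] lemma cl_all (s t : Set ℕ) (x : ℕ) (φ : Fml L) :
    Cl s t (.all x φ) ↔ Cl (insert x s) t φ := by
  simp [Cl, fv, sv, rv, Ok]
@[simp] lemma cl_fex (s t : Set ℕ) (x : ℕ) (φ : Fml L) :
    Cl s t (fex x φ) ↔ Cl (insert x s) t φ := by
  simp [fex]
@[simp] lemma cl_aa (s t : Set ℕ) (x : ℕ) (φ : Fml L) :
    Cl s t (.qAA x φ) ↔ Cl s (insert x t) φ := by
  simp [Cl, fv, sv, rv, Ok, Laa]
@[simp] lemma cl_eq (s t : Set ℕ) (x y : L.Term ℕ) :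
    Cl s t (.eq x y) ↔ tvars x ⊆ s ∧ tvars y ⊆ s := by
  simp [Cl, fv, sv, rv, Ok]
@[simp] lemma cl_mem (s t : Set ℕ) (X : ℕ) (y : L.Term ℕ) :
    Cl s t (.mem X y) ↔ tvars y ⊆ s ∧ X ∈ t := by
  simp [Cl, fv, sv, rv, Ok]
@[simp] lemma tvars_var (i : ℕ) : tvars (.var i : L.Term ℕ) = {i} := rfl

end Comb

section Sem

variable {N : Type} [(LX L).Structure N]

/-- The order symbol. -/
abbrev yLe (L : FirstOrder.Language.{0,0}) : (LX L).Relations 2 := Sum.inr XR.le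
/-- The coding symbol. -/
abbrev yE (L : FirstOrder.Language.{0,0}) : (LX L).Relations 2 := Sum.inr XR.ee
/-- The retraction symbol. -/
abbrev yPi (L : FirstOrder.Language.{0,0}) : (LX L).Functions 1 := Sum.inr XF.pi
/-- The surjection symbols. -/
abbrev yG (L : FirstOrder.Language.{0,0}) (b : Bool) : (LX L).Functions 4 := Sum.inr (XF.g b)

/-- Interpretation of the order symbol. -/
def sLe (L : FirstOrder.Language.{0,0}) {N : Type} [(LX L).Structure N] (x y : N) : Prop :=
  Language.Structure.RelMap (yLe L) ![x, y]
/-- Interpretation of the coding symbol. -/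
def sE (L : FirstOrder.Language.{0,0}) {N : Type} [(LX L).Structure N] (x y : N) : Prop :=
  Language.Structure.RelMap (yE L) ![x, y]
/-- Interpretation of the retraction symbol. -/
def sPi (L : FirstOrder.Language.{0,0}) {N : Type} [(LX L).Structure N] (x : N) : N :=
  Language.Structure.funMap (yPi L) ![x]
/-- Interpretation of the parametrized surjections. -/
def sG (L : FirstOrder.Language.{0,0}) {N : Type} [(LX L).Structure N] (b : Bool) (p q w x : N) : N :=
  Language.Structure.funMap (yG L b) ![p, q, w, x]
/-- The order or its converse. -/
def sR (L : FirstOrder.Language.{0,0}) {N : Type} [(LX L).Structure N] (b : Bool) (x y : N) : Prop :=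
  cond b (sLe L x y) (sLe L y x)

/-- Term for the retraction. -/
def tPi (t : (LX L).Term ℕ) : (LX L).Term ℕ := .func (yPi L) ![t]
/-- Term for the surjections. -/
def tG (b : Bool) (p q w x : ℕ) : (LX L).Term ℕ :=
  .func (yG L b) ![.var p, .var q, .var w, .var x]
/-- Order formula. -/
def fLe (s t : (LX L).Term ℕ) : Fml (LX L) := .rel (yLe L) ![s, t]
/-- Coding formula. -/
def fEt (s t : (LX L).Term ℕ) : Fml (LX L) := .rel (yE L) ![s, t]
/-- Coding formula on variables. -/
def fE (s t : ℕ) : Fml (LX L) := fEt (.var s) (.var t)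
/-- Order formula or its converse on variables. -/
def fR (b : Bool) (s t : ℕ) : Fml (LX L) := cond b (fLe (.var s) (.var t)) (fLe (.var t) (.var s))

variable (va : ℕ → N) (vs : ℕ → Set N) (vr : ℕ → N → N → Prop)

@[simp] lemma real_tPi (t : (LX L).Term ℕ) : (tPi t).realize va = sPi L (t.realize va) := by
  simp only [tPi, sPi, Language.Term.realize_func]
  congr 1
  funext i
  fin_cases i
  rfl
@[simp] lemma real_tG (b : Bool) (p q w x : ℕ) :
    (tG (L := L) b p q w x).realize va = sG L b (va p) (va q) (va w) (va x) := by
  simp only [tG, sG, Language.Term.realize_func]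
  congr 1
  funext i
  fin_cases i <;> rfl
@[simp] lemma eval_fLe (s t : (LX L).Term ℕ) :
    Eval (fLe s t) va vs vr ↔ sLe L (s.realize va) (t.realize va) := by
  simp only [fLe, sLe, Eval]
  refine iff_of_eq (congrArg _ ?_)
  funext i
  fin_cases i <;> rfl
@[simp] lemma eval_fEt (s t : (LX L).Term ℕ) :
    Eval (fEt s t) va vs vr ↔ sE L (s.realize va) (t.realize va) := by
  simp only [fEt, sE, Eval]
  refine iff_of_eq (congrArg _ ?_)
  funext i
  fin_cases i <;> rfl
@[simp] lemma eval_fE (s t : ℕ) :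
    Eval (fE (L := L) s t) va vs vr ↔ sE L (va s) (va t) := by
  simp [fE]
@[simp] lemma eval_fR (b : Bool) (s t : ℕ) :
    Eval (fR (L := L) b s t) va vs vr ↔ sR L b (va s) (va t) := by
  cases b <;> simp [fR, sR]

@[simp] lemma tvars_tPi (t : (LX L).Term ℕ) : tvars (tPi t) = tvars t := by
  ext i
  simp [tPi, tvars]
@[simp] lemma tvars_tG (b : Bool) (p q w x : ℕ) :
    tvars (tG (L := L) b p q w x) = {p, q, w, x} := by
  ext i
  simp [tG, tvars, Fin.exists_fin_succ]
@[simp] lemma cl_fLe (u v : Set ℕ) (s t : (LX L).Term ℕ) :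
    Cl u v (fLe s t) ↔ tvars s ⊆ u ∧ tvars t ⊆ u := by
  simp [fLe, Cl, fv, sv, rv, Ok, Fin.forall_fin_two]
@[simp] lemma cl_fEt (u v : Set ℕ) (s t : (LX L).Term ℕ) :
    Cl u v (fEt s t) ↔ tvars s ⊆ u ∧ tvars t ⊆ u := by
  simp [fEt, Cl, fv, sv, rv, Ok, Fin.forall_fin_two]
@[simp] lemma cl_fE (u v : Set ℕ) (s t : ℕ) :
    Cl u v (fE (L := L) s t) ↔ s ∈ u ∧ t ∈ u := by
  simp [fE]
@[simp] lemma cl_fR (b : Bool) (u v : Set ℕ) (s t : ℕ) :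
    Cl u v (fR (L := L) b s t) ↔ s ∈ u ∧ t ∈ u := by
  cases b <;> simp [fR, and_comm]

/-- The axioms `Ax` as a formula. -/
def fAx (L : FirstOrder.Language.{0,0}) (b : Bool) : Fml (LX L) :=
  fand (.all 0 (.all 1 (fimp (fR b 0 1) (fR b 0 0)))) <|
  fand (.all 0 (.all 1 (fimp (fR b 0 1) (fR b 1 1)))) <|
  fand (.all 0 (.all 1 (.all 2 (fimp (fR b 0 1) (fimp (fR b 1 2) (fR b 0 2)))))) <|
  fand (.all 0 (.all 1 (fimp (fR b 0 1) (fimp (fR b 1 0) (.eq (.var 0) (.var 1)))))) <|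
  fand (.all 0 (.all 1 (fimp (fR b 0 0) (fimp (fR b 1 1) (fdis (fR b 0 1) (fR b 1 0)))))) <|
  fand (.all 0 (.all 1 (fimp (fE 0 1) (fR b 0 0)))) <|
  fand (.all 0 (.all 1 (.all 2 (fex 3 (.all 4 (fiff (fE 4 3)
    (fand (fE 4 0) (fand (.not (fR b 4 1)) (.not (fR b 2 4)))))))))) <|
  fand (.all 0 (.all 1 (.all 2 (fimp (fex 3 (fE 3 0))
    (fimp (.all 3 (fimp (fE 3 0) (fex 4 (fand (fE 4 1) (.not (fR b 4 3))))))
    (fimp (.all 4 (fimp (fE 4 1) (fex 3 (fand (fE 3 0) (.not (fR b 3 4))))))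
    (.all 5 (fimp (fE 5 2) (fex 3 (fand (fE 3 0) (.eq (tG b 0 1 2 3) (.var 5))))))))))))  <|
  fand (.all 0 (.all 1 (.all 2 (.all 3 (.all 4 (fimp (fE 3 0) (fimp (fE 4 0) (fimp (fR b 3 4)
    (fimp (.not (fex 5 (fand (fE 5 1) (fand (fR b 3 5) (fR b 5 4)))))
    (.eq (tG b 0 1 2 3) (tG b 0 1 2 4))))))))))) <|
  (.all 0 (.all 1 (.all 2 (.all 3 (fex 4 (.all 5 (fiff (fE 5 4) (fand (fE 5 2)
    (fex 6 (fand (fE 6 0) (fand (.eq (tG b 0 1 2 6) (.var 5)) (fex 7 (fand (fE 7 3)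
    (fand (fR b 6 7) (.not (fex 8 (fand (fE 8 1) (fand (fR b 6 8) (fR b 8 7)))))))))))))))))))

lemma eval_fAx (b : Bool) : Eval (fAx L b) va vs vr ↔ Ax (sR L b) (sE L) (sG L b (N := N)) := by
  simp only [fAx, eval_fand, eval_all, eval_fimp, eval_fex, eval_fE, eval_fR, eval_fiff, eval_fdis,
    eval_not, eval_eq, real_tG, Language.Term.realize_var, Function.update_apply, reduceIte,
    Nat.reduceEqDiff, OfNat.zero_ne_ofNat, OfNat.ofNat_ne_zero,
    OfNat.one_ne_ofNat, OfNat.ofNat_ne_one, zero_ne_one, one_ne_zero]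
  constructor
  · rintro ⟨h1, h2, h3, h4, h5, h6, h7, h8, h9, h10⟩
    exact ⟨h1, h2, h3, h4, h5, h6, h7, h8, h9, h10⟩
  · rintro ⟨h1, h2, h3, h4, h5, h6, h7, h8, h9, h10⟩
    exact ⟨h1, h2, h3, h4, h5, h6, h7, h8, h9, h10⟩

lemma cl_fAx (b : Bool) : Cl ∅ ∅ (fAx L b) := by
  simp [fAx, Set.insert_subset_iff]

/-- The remaining axioms. -/
structure Ax2 (L : FirstOrder.Language.{0,0}) (N : Type) [(LX L).Structure N] : Prop where
  code : ∃ C : Set (Set N), IsClubFam C ∧ ∀ X ∈ C, ∃ p, ∀ u, sE L u p ↔ u ∈ X ∧ sLe L u u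
  ctbl : ∀ p, ∃ C : Set (Set N), IsClubFam C ∧ ∀ X ∈ C, ∀ u, sE L u p → u ∈ X
  ext : ∀ p q : N, ¬ sLe L p p → ¬ sLe L q q → (∀ u, sE L u p ↔ sE L u q) → p = q
  pi1 : ∀ x : N, sLe L (sPi L x) (sPi L x)
  pi2 : ∀ x : N, sLe L x x → sPi L x = x

/-- The axioms `Ax2` as a formula. -/
def fAx2 (L : FirstOrder.Language.{0,0}) : Fml (LX L) :=
  fand (.qAA 0 (fex 0 (.all 1 (fiff (fE 1 0) (fand (.mem 0 (.var 1)) (fR true 1 1)))))) <|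
  fand (.all 0 (.qAA 0 (.all 1 (fimp (fE 1 0) (.mem 0 (.var 1)))))) <|
  fand (.all 0 (.all 1 (fimp (.not (fR true 0 0)) (fimp (.not (fR true 1 1))
    (fimp (.all 2 (fiff (fE 2 0) (fE 2 1))) (.eq (.var 0) (.var 1))))))) <|
  fand (.all 0 (fLe (tPi (.var 0)) (tPi (.var 0)))) <|
  (.all 0 (fimp (fR true 0 0) (.eq (tPi (.var 0)) (.var 0))))

lemma eval_fAx2 : Eval (fAx2 L) va vs vr ↔ Ax2 L N := by
  simp only [fAx2, eval_fand, eval_all, eval_fimp, eval_fex, eval_fE, eval_fR, eval_fiff, eval_fdis,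
    eval_not, eval_eq, real_tG, Language.Term.realize_var, Function.update_apply, reduceIte,
    eval_aa, eval_mem, eval_fLe, real_tPi, sR, cond_true,
    Nat.reduceEqDiff, OfNat.zero_ne_ofNat, OfNat.ofNat_ne_zero,
    OfNat.one_ne_ofNat, OfNat.ofNat_ne_one, zero_ne_one, one_ne_zero]
  constructor
  · rintro ⟨h1, h2, h3, h4, h5⟩
    exact ⟨h1, h2, h3, h4, h5⟩
  · rintro ⟨h1, h2, h3, h4, h5⟩
    exact ⟨h1, h2, h3, h4, h5⟩

lemma cl_fAx2 : Cl ∅ ∅ (fAx2 L) := by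
  simp [fAx2]

end Sem

/-! ### The translation -/

/-- Old function symbols. -/
abbrev yF {n : ℕ} (f : L.Functions n) : (LX L).Functions n := Sum.inl f
/-- Old relation symbols. -/
abbrev yR {n : ℕ} (R : L.Relations n) : (LX L).Relations n := Sum.inl R

/-- Translation of terms. -/
def trT : L.Term ℕ → (LX L).Term ℕ
  | .var x => tPi (.var (2 * x))
  | .func f ts => tPi (.func (yF f) (fun i => trT (ts i)))

/-- Translation of formulas. -/
def tr : Fml L → Fml (LX L)
  | .rel R ts => .rel (yR R) (fun i => trT (ts i))
  | .eq s t => .eq (trT s) (trT t)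
  | .mem X t => fEt (trT t) (.var (2 * X + 1))
  | .rmem R s t => .rmem R (trT s) (trT t)
  | .not φ => .not (tr φ)
  | .conj ι f => .conj ι (fun i => tr (f i))
  | .all x φ => .all (2 * x) (tr φ)
  | .qC X φ => fex (2 * X + 1) (tr φ)
  | .qWo _ _ φ => tr φ
  | .qAA _ φ => tr φ
  | .qII _ φ => tr φ
  | .qCf _ _ φ => tr φ

/-- `M` is a retract of `N`, whose countable sets are exactly those coded in `N`. -/
structure Ret (L : FirstOrder.Language.{0,0}) {M N : Type} [L.Structure M] [(LX L).Structure N]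
    (e : M → N) (p : N → M) : Prop where
  pi : ∀ x, sPi L x = e (p x)
  pe : ∀ a, p (e a) = a
  fn : ∀ (n : ℕ) (f : L.Functions n) (xs : Fin n → M), Language.Structure.funMap f xs =
    p (Language.Structure.funMap (yF f) (fun i => e (xs i)))
  rl : ∀ (n : ℕ) (R : L.Relations n) (xs : Fin n → M), Language.Structure.RelMap R xs ↔
    Language.Structure.RelMap (yR R) (fun i => e (xs i))
  cod : ∀ S : Set M, S.Countable → ∃ q, ∀ a, a ∈ S ↔ sE L (e a) q
  ctb : ∀ q, {a | sE L (e a) q}.Countable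

section Tr

variable {M N : Type} [L.Structure M] [(LX L).Structure N] {e : M → N} {p : N → M}

lemma real_trT (h : Ret L e p) (va : ℕ → N) (t : L.Term ℕ) :
    (trT t).realize va = e (t.realize (fun n => p (va (2 * n)))) := by
  induction t with
  | var x => simp [trT, h.pi]
  | func f ts ih =>
    simp only [trT, real_tPi, h.pi, Language.Term.realize_func, h.fn, ih]

lemma eval_tr (h : Ret L e p) (φ : Fml L) : Ok Lc φ → ∀ (va : ℕ → N) (vs : ℕ → Set M)
    (vsN : ℕ → Set N) (vrN : ℕ → N → N → Prop) (vr : ℕ → M → M → Prop),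
    (∀ R a b, vr R a b ↔ vrN R (e a) (e b)) →
    (∀ X ∈ sv φ, ∀ a, a ∈ vs X ↔ sE L (e a) (va (2 * X + 1))) →
    (Eval (tr φ) va vsN vrN ↔ Eval φ (fun n => p (va (2 * n))) vs vr) := by
  classical
  have einj : Function.Injective e := Function.LeftInverse.injective h.pe
  induction φ with
  | rel R ts =>
    intro _ va vs vsN vrN vr _ _
    simp only [tr, Eval, real_trT h, h.rl]
  | eq s t =>
    intro _ va vs vsN vrN vr _ _
    simp only [tr, Eval, real_trT h, einj.eq_iff]
  | mem X t =>
    intro _ va vs vsN vrN vr _ hs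
    simp only [tr, eval_fEt, real_trT h, Eval, hs X rfl]
    rfl
  | rmem R s t =>
    intro _ va vs vsN vrN vr hr hs
    simp only [tr, real_trT h, Eval, hr]
  | not φ ih =>
    intro ok va vs vsN vrN vr hr hs
    simp only [tr, Eval]
    rw [ih ok va vs vsN vrN vr hr hs]
  | conj ι f ih =>
    intro ok va vs vsN vrN vr hr hs
    simp only [tr, Eval]
    exact forall_congr' fun i => ih i (ok.2 i) va vs vsN vrN vr hr
      (fun X hX => hs X (Set.mem_iUnion.2 ⟨i, hX⟩))
  | all x φ ih =>
    intro ok va vs vsN vrN vr hr hs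
    have e1 : ∀ a : N, (fun n => p (Function.update va (2 * x) a (2 * n))) =
        Function.update (fun n => p (va (2 * n))) x (p a) := by
      intro a
      funext n
      by_cases hn : n = x
      · subst hn; simp
      · rw [Function.update_of_ne hn, Function.update_of_ne (by omega)]
    have e2 : ∀ a : N, Eval (tr φ) (Function.update va (2 * x) a) vsN vrN ↔
        Eval φ (Function.update (fun n => p (va (2 * n))) x (p a)) vs vr := by
      intro a
      rw [ih ok (Function.update va (2 * x) a) vs vsN vrN vr hr ?_, e1]
      intro X hX b
      rw [Function.update_of_ne (by omega)]
      exact hs X hX b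
    simp only [tr, Eval, e2]
    constructor
    · intro H a
      have := H (e a)
      rwa [h.pe] at this
    · intro H a
      exact H _
  | qC X φ ih =>
    intro ok va vs vsN vrN vr hr hs
    have e1 : ∀ a : N, (fun n => p (Function.update va (2 * X + 1) a (2 * n))) =
        (fun n => p (va (2 * n))) := by
      intro a
      funext n
      rw [Function.update_of_ne (by omega)]
    have e2 : ∀ (q : N) (S : Set M), (∀ a, a ∈ S ↔ sE L (e a) q) →
        (Eval (tr φ) (Function.update va (2 * X + 1) q) vsN vrN ↔
        Eval φ (fun n => p (va (2 * n))) (Function.update vs X S) vr) := by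
      intro q S hS
      rw [ih ok.2 (Function.update va (2 * X + 1) q) (Function.update vs X S) vsN vrN vr hr ?_, e1]
      intro Y hY b
      by_cases hYX : Y = X
      · subst hYX
        simp [hS]
      · rw [Function.update_of_ne hYX, Function.update_of_ne (by omega)]
        exact hs Y ⟨hY, hYX⟩ b
    simp only [tr, eval_fex]
    constructor
    · rintro ⟨q, hq⟩
      exact ⟨_, h.ctb q, (e2 q _ (fun a => Iff.rfl)).1 hq⟩
    · rintro ⟨S, hS, hφ⟩
      obtain ⟨q, hq⟩ := h.cod S hS
      exact ⟨q, (e2 q S hq).2 hφ⟩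
  | qWo x y φ ih => intro ok; exact ok.1.elim
  | qAA x φ ih => intro ok; exact ok.1.elim
  | qII x φ ih => intro ok; exact ok.1.elim
  | qCf x y φ ih => intro ok; exact ok.1.elim

lemma sat_tr (h : Ret L e p) (φ : Fml L) (hφ : IsSentence φ) (ok : Ok Lc φ)
    (va : ℕ → N) (vs : ℕ → Set N) (vr : ℕ → N → N → Prop) (H : Sat M φ) :
    Eval (tr φ) va vs vr := by
  rw [eval_tr h φ ok va (fun _ => ∅) vs vr (fun R a b => vr R (e a) (e b)) (fun _ _ _ => Iff.rfl)
    (by rw [hφ.2.1]; simp)]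
  exact H _ _ _

lemma sat_of_tr (h : Ret L e p) (φ : Fml L) (hφ : IsSentence φ) (ok : Ok Lc φ)
    (H : ∀ (va : ℕ → N) (vs : ℕ → Set N) (vr : ℕ → N → N → Prop), Eval (tr φ) va vs vr) :
    Sat M φ := by
  intro va vs vr
  have := (eval_tr h φ ok (fun n => e (va (n / 2))) vs (fun _ => ∅)
    (fun R x y => vr R (p x) (p y)) vr (fun R a b => by simp [h.pe])
    (by rw [hφ.2.1]; simp)).1 (H _ _ _)
  simpa [h.pe] using this

end Tr

lemma tvars_trT (t : L.Term ℕ) : tvars (trT t) = (fun n => 2 * n) '' tvars t := by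
  induction t with
  | var x => simp [trT, tvars]
  | func f ts ih => simp [trT, tvars, ih, Set.image_iUnion]

lemma cl_tr (φ : Fml L) : Ok Lc φ →
    fv (tr φ) ⊆ (fun n => 2 * n) '' fv φ ∪ (fun n => 2 * n + 1) '' sv φ ∧
    sv (tr φ) = ∅ ∧ rv (tr φ) = rv φ ∧ Ok Laa (tr φ) := by
  induction φ with
  | rel R ts =>
    intro _
    simp [tr, fv, sv, rv, Ok, tvars_trT, Set.image_iUnion]
  | eq s t =>
    intro _
    simp [tr, fv, sv, rv, Ok, tvars_trT, Set.image_union]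
  | mem X t =>
    intro _
    refine ⟨?_, rfl, rfl, trivial⟩
    intro i hi
    simp only [tr, fEt, fv, Set.mem_iUnion, Fin.exists_fin_two] at hi
    rcases hi with hi | hi
    · left
      simpa [tvars_trT, fv] using hi
    · right
      simpa [sv, eq_comm] using hi
  | rmem R s t =>
    intro _
    simp [tr, fv, sv, rv, Ok, tvars_trT, Set.image_union]
  | not φ ih =>
    intro ok
    exact ih ok
  | conj ι f ih =>
    intro ok
    have := fun i => ih i (ok.2 i)
    refine ⟨?_, ?_, ?_, ok.1, fun i => (this i).2.2.2⟩
    · simp only [tr, fv, sv]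
      refine Set.iUnion_subset fun i => (this i).1.trans ?_
      exact Set.union_subset_union (Set.image_mono (Set.subset_iUnion_of_subset i subset_rfl))
        (Set.image_mono (Set.subset_iUnion_of_subset i subset_rfl))
    · simp [tr, sv, fun i => (this i).2.1]
    · simp [tr, rv, fun i => (this i).2.2.1]
  | all x φ ih =>
    intro ok
    have := ih ok
    refine ⟨?_, this.2.1, this.2.2.1, this.2.2.2⟩
    rintro i ⟨hi, hx⟩
    rcases this.1 hi with ⟨n, hn, rfl⟩ | ⟨n, hn, rfl⟩
    · left
      exact ⟨n, ⟨hn, fun h => hx (by rw [h]; rfl)⟩, rfl⟩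
    · right
      exact ⟨n, hn, rfl⟩
  | qC X φ ih =>
    intro ok
    have := ih ok.2
    refine ⟨?_, this.2.1, this.2.2.1, this.2.2.2⟩
    rintro i ⟨hi, hx⟩
    rcases this.1 hi with ⟨n, hn, rfl⟩ | ⟨n, hn, rfl⟩
    · left
      exact ⟨n, hn, rfl⟩
    · right
      exact ⟨n, ⟨hn, fun h => hx (by rw [h]; rfl)⟩, rfl⟩
  | qWo x y φ ih => intro ok; exact ok.1.elim
  | qAA x φ ih => intro ok; exact ok.1.elim
  | qII x φ ih => intro ok; exact ok.1.elim
  | qCf x y φ ih => intro ok; exact ok.1.elim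

/-- The sentence of stationary logic attached to `φ`. -/
def psi (φ : Fml L) : Fml (LX L) :=
  fand (fAx L true) (fand (fAx L false) (fand (fAx2 L) (tr φ)))

lemma cl_psi (φ : Fml L) (hφ : IsSentence φ) (ok : Ok Lc φ) : Cl ∅ ∅ (psi φ) := by
  simp only [psi, cl_fand, cl_fAx, cl_fAx2, true_and]
  obtain ⟨h1, h2, h3, h4⟩ := cl_tr φ ok
  refine ⟨?_, h2.subset, h3.trans hφ.2.2, h4⟩
  rw [hφ.1, hφ.2.1] at h1
  simpa using h1

lemma eval_psi {N : Type} [(LX L).Structure N] (va : ℕ → N) (vs : ℕ → Set N)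
    (vr : ℕ → N → N → Prop) (φ : Fml L) : Eval (psi φ) va vs vr ↔
      (Ax (sR L true) (sE L) (sG L true (N := N)) ∧ Ax (sR L false) (sE L) (sG L false (N := N)) ∧
        Ax2 L N ∧ Eval (tr φ) va vs vr) := by
  simp only [psi, eval_fand, eval_fAx, eval_fAx2]

/-! ### Models of `psi φ` -/

lemma bdd_psi (φ : Fml L) (hφ : IsSentence φ) (ok : Ok Lc φ) (hb : BddSpec φ) :
    BddSpec (psi φ) := by
  classical
  obtain ⟨κ, hκ⟩ := hb
  let μ := max bigCard κ
  refine ⟨Order.succ (μ + 2 ^ μ), fun N SN hN => Order.lt_succ_of_le ?_⟩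
  rcases isEmpty_or_nonempty N with hE | ⟨⟨n0⟩⟩
  · simp
  have hev := fun va vs vr => (eval_psi (N := N) va vs vr φ).1 (hN va vs vr)
  obtain ⟨ax, ax', ax2, -⟩ := hev (fun _ => n0) (fun _ => ∅) (fun _ _ _ => True)
  have htr : ∀ (va : ℕ → N) (vs : ℕ → Set N) (vr : ℕ → N → N → Prop), Eval (tr φ) va vs vr :=
    fun va vs vr => (hev va vs vr).2.2.2
  have hU : #{x : N // sLe L x x} ≤ μ := by
    by_contra hcon
    have hbig : bigCard < #{x : N // sLe L x x} := (le_max_left _ _).trans_lt (not_le.1 hcon)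
    obtain ⟨C, hC, hco⟩ := ax2.code
    have hcode := code_all (R := sLe L) ax ax' hC hco hbig
    letI SU : L.Structure {x : N // sLe L x x} :=
      { funMap := fun f xs => ⟨sPi L (Language.Structure.funMap (yF f) (fun i => (xs i).1)),
          ax2.pi1 _⟩
        RelMap := fun R xs => Language.Structure.RelMap (yR R) (fun i => (xs i).1) }
    have hret : Ret L (M := {x : N // sLe L x x}) (N := N) Subtype.val
        (fun x => ⟨sPi L x, ax2.pi1 x⟩) :=
      { pi := fun x => rfl
        pe := fun a => Subtype.ext (ax2.pi2 _ a.2)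
        fn := fun n f xs => rfl
        rl := fun n f xs => Iff.rfl
        cod := by
          intro S hS
          obtain ⟨q, hq⟩ := hcode (Subtype.val '' S) (hS.image _) (by
            rintro _ ⟨x, _, rfl⟩
            exact x.2)
          refine ⟨q, fun a => ?_⟩
          rw [hq]
          exact ⟨fun h => ⟨a, h, rfl⟩, fun ⟨b, hb, hba⟩ => Subtype.ext hba ▸ hb⟩
        ctb := by
          intro q
          obtain ⟨C, hC, hCq⟩ := ax2.ctbl q
          obtain ⟨T, hT, -⟩ := hC.2.2 ∅ (by simp)
          exact ((hC.1 T hT).preimage Subtype.val_injective).mono (fun a ha => hCq T hT _ ha) }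
    have hsat := sat_of_tr hret φ hφ ok htr
    exact hcon ((hκ _ SU hsat).le.trans (le_max_right _ _))
  have hinj : Function.Injective (fun x : N => if h : sLe L x x then
      (Sum.inl ⟨x, h⟩ : {x : N // sLe L x x} ⊕ Set {x : N // sLe L x x})
      else Sum.inr {u | sE L u.1 x}) := by
    intro x y hxy
    by_cases hx : sLe L x x
    · by_cases hy : sLe L y y
      · simpa [hx, hy] using hxy
      · simp [hx, hy] at hxy
    · by_cases hy : sLe L y y
      · simp [hx, hy] at hxy
      · simp only [hx, hy, dif_neg, not_false_eq_true, Sum.inr.injEq] at hxy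
        refine ax2.ext x y hx hy fun u => ?_
        constructor
        · intro h
          have : (⟨u, ax.eu _ _ h⟩ : {x : N // sLe L x x}) ∈ {u : {x : N // sLe L x x} | sE L u.1 x} := h
          rw [hxy] at this
          exact this
        · intro h
          have : (⟨u, ax.eu _ _ h⟩ : {x : N // sLe L x x}) ∈ {u : {x : N // sLe L x x} | sE L u.1 y} := h
          rw [← hxy] at this
          exact this
  refine (Cardinal.mk_le_of_injective hinj).trans ?_
  rw [Cardinal.mk_sum, Cardinal.mk_set]
  simp only [Cardinal.lift_id]
  exact add_le_add hU (Cardinal.power_le_power_left two_ne_zero hU)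

lemma exists_G {N : Type} (R E : N → N → Prop)
    (r1 : ∀ x y, R x y → R x x) (r2 : ∀ x y, R x y → R y y)
    (htr : ∀ x y z, R x y → R y z → R x z) (asy : ∀ x y, R x y → R y x → x = y)
    (tot : ∀ x y, R x x → R y y → R x y ∨ R y x) (eu : ∀ u p, E u p → R u u)
    (ctb : ∀ p, {x | E x p}.Countable)
    (cod : ∀ S : Set N, S.Countable → (∀ x ∈ S, R x x) → ∃ p, ∀ u, E u p ↔ u ∈ S) :
    ∃ G, Ax R E G := by
  classical
  have H : ∀ p q w, ∃ g : N → N, ((∃ x, E x p) → (∀ x, E x p → ∃ y, E y q ∧ ¬ R y x) →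
      (∀ y, E y q → ∃ x, E x p ∧ ¬ R x y) → ∀ z, E z w → ∃ x, E x p ∧ g x = z) ∧
      (∀ x x', E x p → E x' p → R x x' → (¬ ∃ y, E y q ∧ R x y ∧ R y x') → g x = g x') := by
    intro p q w
    by_cases h : ((∃ x, E x p) ∧ (∀ x, E x p → ∃ y, E y q ∧ ¬ R y x) ∧
      (∀ y, E y q → ∃ x, E x p ∧ ¬ R x y)) ∧ (∃ z, E z w)
    · obtain ⟨⟨⟨x0, hx0⟩, h1, h2⟩, hw⟩ := h
      obtain ⟨e, he⟩ := (ctb w).exists_eq_range hw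
      let P := {x // E x p}
      let Q := {x // E x q}
      have h1' : ∀ x : P, ∃ y : Q, ¬ R y.1 x.1 := fun x => by
        obtain ⟨y, hy, h⟩ := h1 x.1 x.2
        exact ⟨⟨y, hy⟩, h⟩
      have h2' : ∀ x : Q, ∃ y : P, ¬ R y.1 x.1 := fun x => by
        obtain ⟨y, hy, h⟩ := h2 x.1 x.2
        exact ⟨⟨y, hy⟩, h⟩
      choose Y hY using h1'
      choose X hX using h2'
      let x : ℕ → P := fun n => Nat.rec ⟨x0, hx0⟩ (fun _ a => X (Y a)) n
      let y : ℕ → Q := fun n => Y (x n)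
      have a1 : ∀ n, ¬ R (y n).1 (x n).1 := fun n => hY _
      have a2 : ∀ n, ¬ R (x (n + 1)).1 (y n).1 := fun n => hX _
      have a1' : ∀ n, R (x n).1 (y n).1 := fun n =>
        (tot _ _ (eu _ _ (x n).2) (eu _ _ (y n).2)).resolve_right (a1 n)
      have a2' : ∀ n, R (y n).1 (x (n + 1)).1 := fun n =>
        (tot _ _ (eu _ _ (y n).2) (eu _ _ (x (n + 1)).2)).resolve_right (a2 n)
      have a3 : ∀ m d, R (y m).1 (x (m + 1 + d)).1 := by
        intro m d
        induction d with
        | zero => exact a2' m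
        | succ d ih => exact htr _ _ _ ih (htr _ _ _ (a1' _) (a2' _))
      refine ⟨fun u => e (sInf {n | ¬ R (y n).1 u}), fun _ _ _ z hz => ?_, ?_⟩
      · have hz' : z ∈ {x | E x w} := hz
        rw [he] at hz'
        obtain ⟨n, rfl⟩ := hz'
        refine ⟨(x n).1, (x n).2, ?_⟩
        refine congrArg e ?_
        have hmem : n ∈ {m | ¬ R (y m).1 (x n).1} := a1 n
        apply le_antisymm
        · exact Nat.sInf_le hmem
        · by_contra hlt
          have h3 := Nat.sInf_mem ⟨n, hmem⟩
          obtain ⟨d, hd⟩ := Nat.exists_eq_add_of_lt (not_le.1 hlt)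
          refine h3 ?_
          have h4 := a3 (sInf {m | ¬ R (y m).1 (x n).1}) d
          rwa [show sInf {m | ¬ R (y m).1 (x n).1} + 1 + d = n by omega] at h4
      · intro u u' hu hu' huu hno
        have : {n | ¬ R (y n).1 u} = {n | ¬ R (y n).1 u'} := by
          ext n
          simp only [Set.mem_setOf_eq, not_iff_not]
          constructor
          · intro h
            exact htr _ _ _ h huu
          · intro h
            by_contra hn
            exact hno ⟨(y n).1, (y n).2,
              (tot _ _ (eu _ _ hu) (eu _ _ (y n).2)).resolve_right hn, h⟩
        simp only [this]
    · refine ⟨fun _ => p, fun h1 h2 h3 z hz => absurd ⟨⟨h1, h2, h3⟩, z, hz⟩ h, fun _ _ _ _ _ _ => rfl⟩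
  choose G hG1 hG2 using H
  refine ⟨G, r1, r2, htr, asy, tot, eu, ?_, hG1, hG2, ?_⟩
  · intro p a b
    exact cod {x | E x p ∧ ¬ R x a ∧ ¬ R b x} ((ctb p).mono fun x hx => hx.1)
      (fun x hx => eu _ _ hx.1)
  · intro p q w v
    exact cod {z | E z w ∧ ∃ x, E x p ∧ G p q w x = z ∧
      ∃ y, E y v ∧ R x y ∧ ¬ ∃ u, E u q ∧ R x u ∧ R u y} ((ctb w).mono fun x hx => hx.1)
      (fun x hx => eu _ _ hx.1)

section TrueModel

/-- The universe of the true model. -/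
abbrev TN (M : Type) : Type := M ⊕ {s : Set M // s.Countable}

/-- Coding relation in the true model. -/
def tE (M : Type) : TN M → TN M → Prop
  | .inl a, .inr s => a ∈ s.1
  | _, _ => False

/-- Order in the true model. -/
def tR {M : Type} (r : M → M → Prop) : TN M → TN M → Prop
  | .inl a, .inl b => r a b
  | _, _ => False

/-- Structure of the true model. -/
@[reducible] def trueStr (M : Type) [L.Structure M] (pr : TN M → M) (r : M → M → Prop)
    (G : Bool → TN M → TN M → TN M → TN M → TN M) : (LX L).Structure (TN M) where
  funMap := fun {n} f => match n, f with
    | _, .inl f => fun xs => .inl (Language.Structure.funMap f (fun i => pr (xs i)))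
    | _, .inr XF.pi => fun xs => .inl (pr (xs 0))
    | _, .inr (XF.g b) => fun xs => G b (xs 0) (xs 1) (xs 2) (xs 3)
  RelMap := fun {n} f => match n, f with
    | _, .inl R => fun xs => Language.Structure.RelMap R (fun i => pr (xs i))
    | _, .inr XR.le => fun xs => tR r (xs 0) (xs 1)
    | _, .inr XR.ee => fun xs => tE M (xs 0) (xs 1)

lemma tG_ex {M : Type} (r : M → M → Prop) (h0 : ∀ x, r x x) (h1 : ∀ x y z, r x y → r y z → r x z)
    (h2 : ∀ x y, r x y → r y x → x = y) (h3 : ∀ x y, r x y ∨ r y x) :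
    ∃ G, Ax (tR r) (tE M) G := by
  apply exists_G
  · rintro (x | x) (y | y) h
    · exact h0 x
    all_goals exact h.elim
  · rintro (x | x) (y | y) h
    · exact h0 y
    all_goals exact h.elim
  · rintro (x | x) (y | y) (z | z) h h'
    · exact h1 _ _ _ h h'
    all_goals first | exact h.elim | exact h'.elim
  · rintro (x | x) (y | y) h h'
    · exact congrArg _ (h2 _ _ h h')
    all_goals exact h.elim
  · rintro (x | x) (y | y) h h'
    · exact h3 x y
    all_goals first | exact h.elim | exact h'.elim
  · rintro (x | x) (y | y) h
    · exact h.elim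
    · exact h0 x
    all_goals exact h.elim
  · rintro (p | p)
    · convert Set.countable_empty (α := TN M)
      ext x
      rcases x with x | x <;> simp [tE]
    · refine (p.2.image Sum.inl).mono ?_
      rintro (x | x) h
      · exact ⟨x, h, rfl⟩
      · exact h.elim
  · intro S hS hSR
    refine ⟨.inr ⟨Sum.inl ⁻¹' S, hS.preimage Sum.inl_injective⟩, ?_⟩
    rintro (x | x)
    · rfl
    · exact ⟨fun h => h.elim, fun h => (hSR _ h).elim⟩

lemma club_all {N : Type} (T : Set N) (hT : T.Countable) :
    IsClubFam {X : Set N | X.Countable ∧ T ⊆ X} := by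
  refine ⟨fun S h => h.1, fun f hf _ => ⟨Set.countable_iUnion fun n => (hf n).1, ?_⟩, fun S hS => ?_⟩
  · exact (hf 0).2.trans (Set.subset_iUnion f 0)
  · exact ⟨S ∪ T, ⟨hS.union hT, Set.subset_union_right⟩, Set.subset_union_left⟩

lemma true_model (φ : Fml L) (hφ : IsSentence φ) (ok : Ok Lc φ) (M : Type) [SM : L.Structure M]
    [Nonempty M] (hM : Sat M φ) : ∃ S : (LX L).Structure (TN M), @Sat (LX L) (TN M) S (psi φ) := by
  classical
  letI : LinearOrder M := linearOrderOfSTO WellOrderingRel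
  obtain ⟨G1, hG1⟩ := tG_ex (M := M) (fun x y => x ≤ y) le_refl (fun _ _ _ => le_trans)
    (fun _ _ => le_antisymm) le_total
  obtain ⟨G0, hG0⟩ := tG_ex (M := M) (fun x y => y ≤ x) le_refl (fun _ _ _ h h' => le_trans h' h)
    (fun _ _ h h' => le_antisymm h' h) (fun x y => le_total y x)
  let pr : TN M → M := fun x => Sum.elim id (fun _ => Classical.arbitrary M) x
  letI S : (LX L).Structure (TN M) := trueStr M pr (fun x y => x ≤ y) (fun b => cond b G1 G0)
  have eLe : ∀ x y : TN M, sLe L x y ↔ tR (fun x y => x ≤ y) x y := fun x y => Iff.rfl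
  have eE : ∀ x y : TN M, sE L x y ↔ tE M x y := fun x y => Iff.rfl
  have ePi : ∀ x : TN M, sPi L x = .inl (pr x) := fun x => rfl
  refine ⟨S, fun va vs vr => ?_⟩
  rw [eval_psi]
  refine ⟨hG1, ?_, ?_, ?_⟩
  · have : sR L (N := TN M) false = tR (fun x y : M => y ≤ x) := by
      funext x y
      rcases x with x | x <;> rcases y with y | y <;> rfl
    rw [this]
    exact hG0
  · refine ⟨⟨_, club_all ∅ (by simp), ?_⟩, ?_, ?_, ?_, ?_⟩
    · rintro X ⟨hX, -⟩
      refine ⟨.inr ⟨Sum.inl ⁻¹' X, hX.preimage Sum.inl_injective⟩, ?_⟩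
      rintro (u | u)
      · exact ⟨fun h => ⟨h, le_refl u⟩, fun h => h.1⟩
      · exact ⟨fun h => h.elim, fun h => h.2.elim⟩
    · intro p
      rcases p with p | p
      · refine ⟨_, club_all ∅ (by simp), ?_⟩
        rintro X _ (u | u) h <;> exact h.elim
      · refine ⟨_, club_all _ (p.2.image Sum.inl), ?_⟩
        rintro X ⟨_, hX⟩ (u | u) h
        · exact hX ⟨u, h, rfl⟩
        · exact h.elim
    · rintro (p | p) (q | q) h1 h2 h3
      · exact absurd (le_refl p) h1
      · exact absurd (le_refl p) h1
      · exact absurd (le_refl q) h2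
      · refine congrArg _ (Subtype.ext (Set.ext fun u => ?_))
        exact h3 (.inl u)
    · intro x
      exact le_refl (pr x)
    · rintro (x | x) h
      · rfl
      · exact h.elim
  · have hret : Ret L (M := M) (N := TN M) Sum.inl pr :=
      { pi := fun x => rfl
        pe := fun x => rfl
        fn := fun n f xs => rfl
        rl := fun n f xs => Iff.rfl
        cod := fun s hs => ⟨.inr ⟨s, hs⟩, fun a => Iff.rfl⟩
        ctb := by
          rintro (q | q)
          · convert Set.countable_empty (α := M)
            ext x
            exact ⟨fun h => h.elim, fun h => h.elim⟩
          · exact q.2 }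
    exact sat_tr hret φ hφ ok va vs vr hM

end TrueModel

lemma mk_lt_hanfVal (ψ : Fml L) (hb : BddSpec ψ) (M : Type) (S : L.Structure M)
    (h : @Sat L M S ψ) : Order.succ #M ≤ hanfVal ψ := by
  obtain ⟨κ, hκ⟩ := hb
  refine le_csSup ⟨κ, ?_⟩ ⟨M, S, h, rfl⟩
  rintro _ ⟨M', S', h', rfl⟩
  exact Order.succ_le_of_lt (hκ M' S' h')

lemma hanfVal_psi (φ : Fml L) (hφ : IsSentence φ) (ok : Ok Lc φ) (hb : BddSpec φ) :
    hanfVal φ ≤ hanfVal (psi φ) := by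
  refine csSup_le' ?_
  rintro _ ⟨M, S, h, rfl⟩
  have hb' := bdd_psi φ hφ ok hb
  rcases isEmpty_or_nonempty M with hE | hne
  · obtain ⟨S'⟩ : Nonempty ((LX L).Structure M) := by
      classical
      by_cases hf : Nonempty (L.Functions 0)
      · obtain ⟨f⟩ := hf
        exact hE.elim (Language.Structure.funMap f Fin.elim0)
      · refine ⟨{ funMap := fun {n} f xs => ?_, RelMap := fun _ _ => True }⟩
        cases n with
        | zero =>
          rcases f with f | f
          · exact (hf ⟨f⟩).elim
          · exact nomatch f
        | succ n => exact hE.elim (xs 0)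
    exact mk_lt_hanfVal _ hb' M S' (fun va => hE.elim (va 0))
  · obtain ⟨S', hS'⟩ := true_model φ hφ ok M h
    refine le_trans (Order.succ_le_succ ?_) (mk_lt_hanfVal _ hb' _ S' hS')
    exact Cardinal.mk_le_of_injective Sum.inl_injective

/-! ### Reduction to a single countable vocabulary -/

/-- A universal countable vocabulary. -/
def L0 : FirstOrder.Language.{0,0} := ⟨fun _ => ℕ, fun _ => ℕ⟩

/-- The symbol number `k` of arity `n`. -/
abbrev f0 (n k : ℕ) : L0.Functions n := k
/-- The relation symbol number `k` of arity `n`. -/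
abbrev r0 (n k : ℕ) : L0.Relations n := k

/-- A small type of codes of formulas. -/
inductive Code : Type
  | rel : (n k : ℕ) → (Fin n → L0.Term ℕ) → Code
  | eq : L0.Term ℕ → L0.Term ℕ → Code
  | mem : ℕ → L0.Term ℕ → Code
  | rmem : ℕ → L0.Term ℕ → L0.Term ℕ → Code
  | not : Code → Code
  | conj : (n : ℕ) → (Fin n → Code) → Code
  | all : ℕ → Code → Code
  | qAA : ℕ → Code → Code

/-- The formula with a given code. -/
def dec : Code → Fml L0
  | .rel n k ts => .rel (r0 n k) ts
  | .eq s t => .eq s t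
  | .mem X t => .mem X t
  | .rmem R s t => .rmem R s t
  | .not c => .not (dec c)
  | .conj n f => .conj (Fin n) (fun i => dec (f i))
  | .all x c => .all x (dec c)
  | .qAA X c => .qAA X (dec c)

/-- Function symbols of a term. -/
def tf : L.Term ℕ → Set (Σ n, L.Functions n)
  | .var _ => ∅
  | .func (l := n) f ts => insert ⟨n, f⟩ (⋃ i, tf (ts i))

lemma tf_countable (t : L.Term ℕ) : (tf t).Countable := by
  induction t with
  | var x => exact Set.countable_empty
  | func f ts ih => exact (Set.countable_iUnion ih).insert _

/-- Function symbols of a formula. -/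
def uf : Fml L → Set (Σ n, L.Functions n)
  | .rel _ ts => ⋃ i, tf (ts i)
  | .eq s t => tf s ∪ tf t
  | .mem _ t => tf t
  | .rmem _ s t => tf s ∪ tf t
  | .not φ => uf φ
  | .conj _ f => ⋃ i, uf (f i)
  | .all _ φ => uf φ
  | .qWo _ _ φ => uf φ
  | .qC _ φ => uf φ
  | .qAA _ φ => uf φ
  | .qII _ φ => uf φ
  | .qCf _ _ φ => uf φ

/-- Relation symbols of a formula. -/
def ur : Fml L → Set (Σ n, L.Relations n)
  | .rel (n := n) R _ => {⟨n, R⟩}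
  | .eq _ _ => ∅
  | .mem _ _ => ∅
  | .rmem _ _ _ => ∅
  | .not φ => ur φ
  | .conj _ f => ⋃ i, ur (f i)
  | .all _ φ => ur φ
  | .qWo _ _ φ => ur φ
  | .qC _ φ => ur φ
  | .qAA _ φ => ur φ
  | .qII _ φ => ur φ
  | .qCf _ _ φ => ur φ

lemma used_countable (φ : Fml L) : Ok Laa φ → (uf φ).Countable ∧ (ur φ).Countable := by
  induction φ with
  | rel R ts =>
    intro _
    exact ⟨Set.countable_iUnion fun i => tf_countable _, Set.countable_singleton _⟩
  | eq s t => intro _; exact ⟨(tf_countable _).union (tf_countable _), Set.countable_empty⟩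
  | mem X t => intro _; exact ⟨tf_countable _, Set.countable_empty⟩
  | rmem R s t => intro _; exact ⟨(tf_countable _).union (tf_countable _), Set.countable_empty⟩
  | not φ ih => exact ih
  | conj ι f ih =>
    intro ok
    have h1 : #ι < ℵ₀ := ok.1
    haveI : Finite ι := Cardinal.lt_aleph0_iff_finite.1 h1
    exact ⟨Set.countable_iUnion fun i => (ih i (ok.2 i)).1,
      Set.countable_iUnion fun i => (ih i (ok.2 i)).2⟩
  | all x φ ih => exact ih
  | qAA x φ ih => intro ok; exact ih ok.2
  | qC x φ ih => intro ok; exact ok.1.elim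
  | qWo x y φ ih => intro ok; exact ok.1.elim
  | qII x φ ih => intro ok; exact ok.1.elim
  | qCf x y φ ih => intro ok; exact ok.1.elim

/-- Compatibility of two structures over the symbols in given sets. -/
def Compat (g : (Σ n, L.Functions n) → ℕ) (h : (Σ n, L.Relations n) → ℕ)
    (A : Set (Σ n, L.Functions n)) (B : Set (Σ n, L.Relations n)) (M : Type)
    (S : L.Structure M) (S0 : L0.Structure M) : Prop :=
  (∀ n (f : L.Functions n), ⟨n, f⟩ ∈ A → ∀ xs : Fin n → M,
    S.funMap f xs = S0.funMap (f0 n (g ⟨n, f⟩)) xs) ∧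
  (∀ n (R : L.Relations n), ⟨n, R⟩ ∈ B → ∀ xs : Fin n → M,
    S.RelMap R xs ↔ S0.RelMap (r0 n (h ⟨n, R⟩)) xs)

lemma Compat.mono {g : (Σ n, L.Functions n) → ℕ} {h : (Σ n, L.Relations n) → ℕ}
    {A A' : Set (Σ n, L.Functions n)} {B B' : Set (Σ n, L.Relations n)} {M : Type}
    {S : L.Structure M} {S0 : L0.Structure M} (hc : Compat g h A B M S S0) (hA : A' ⊆ A)
    (hB : B' ⊆ B) : Compat g h A' B' M S S0 :=
  ⟨fun n f hf => hc.1 n f (hA hf), fun n f hf => hc.2 n f (hB hf)⟩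

/-- Translation of terms to the universal vocabulary. -/
def mapT (g : (Σ n, L.Functions n) → ℕ) : L.Term ℕ → L0.Term ℕ
  | .var x => .var x
  | .func (l := n) f ts => .func (f0 n (g ⟨n, f⟩)) (fun i => mapT g (ts i))

lemma real_mapT (g : (Σ n, L.Functions n) → ℕ) (h : (Σ n, L.Relations n) → ℕ)
    (B : Set (Σ n, L.Relations n)) (M : Type) (S : L.Structure M) (S0 : L0.Structure M)
    (t : L.Term ℕ) (hc : Compat g h (tf t) B M S S0) (va : ℕ → M) :
    (mapT g t).realize va = t.realize va := by
  induction t with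
  | var x => rfl
  | func f ts ih =>
    simp only [mapT, Language.Term.realize_func]
    have h1 := hc.1 _ f (Set.mem_insert _ _)
    rw [h1]
    congr 1
    funext i
    have h2 : tf (ts i) ⊆ tf (.func f ts) := fun s hs =>
      Set.mem_insert_of_mem _ (Set.mem_iUnion.2 ⟨i, hs⟩)
    exact ih i (hc.mono h2 subset_rfl)

lemma exists_code (g : (Σ n, L.Functions n) → ℕ) (h : (Σ n, L.Relations n) → ℕ)
    (φ : Fml L) : Ok Laa φ → ∃ c : Code, ∀ (M : Type) (S : L.Structure M) (S0 : L0.Structure M),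
      Compat g h (uf φ) (ur φ) M S S0 → ∀ (va : ℕ → M) (vs : ℕ → Set M) (vr : ℕ → M → M → Prop),
      (Eval φ va vs vr ↔ Eval (dec c) va vs vr) := by
  induction φ with
  | rel R ts =>
    intro _
    refine ⟨.rel _ (h ⟨_, R⟩) (fun i => mapT g (ts i)), fun M S S0 hc va vs vr => ?_⟩
    simp only [dec, Eval]
    rw [hc.2 _ R rfl]
    refine iff_of_eq (congrArg _ (funext fun i => ?_))
    exact (real_mapT g h _ M S S0 (ts i)
      (hc.mono (Set.subset_iUnion_of_subset i subset_rfl) subset_rfl) va).symm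
  | eq s t =>
    intro _
    refine ⟨.eq (mapT g s) (mapT g t), fun M S S0 hc va vs vr => ?_⟩
    simp only [dec, Eval]
    rw [real_mapT g h _ M S S0 s (hc.mono Set.subset_union_left subset_rfl) va,
      real_mapT g h _ M S S0 t (hc.mono Set.subset_union_right subset_rfl) va]
  | mem X t =>
    intro _
    refine ⟨.mem X (mapT g t), fun M S S0 hc va vs vr => ?_⟩
    simp only [dec, Eval]
    rw [real_mapT g h _ M S S0 t hc va]
  | rmem R s t =>
    intro _
    refine ⟨.rmem R (mapT g s) (mapT g t), fun M S S0 hc va vs vr => ?_⟩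
    simp only [dec, Eval]
    rw [real_mapT g h _ M S S0 s (hc.mono Set.subset_union_left subset_rfl) va,
      real_mapT g h _ M S S0 t (hc.mono Set.subset_union_right subset_rfl) va]
  | not φ ih =>
    intro ok
    obtain ⟨c, hc⟩ := ih ok
    exact ⟨.not c, fun M S S0 hM va vs vr => not_congr (hc M S S0 hM va vs vr)⟩
  | conj ι f ih =>
    intro ok
    have h1 : #ι < ℵ₀ := ok.1
    haveI : Finite ι := Cardinal.lt_aleph0_iff_finite.1 h1
    obtain ⟨n, ⟨e⟩⟩ := Finite.exists_equiv_fin ι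
    choose c hc using fun i => ih i (ok.2 i)
    refine ⟨.conj n (fun k => c (e.symm k)), fun M S S0 hM va vs vr => ?_⟩
    simp only [dec, Eval]
    have := fun i => hc i M S S0 (hM.mono (Set.subset_iUnion_of_subset i subset_rfl)
      (Set.subset_iUnion_of_subset i subset_rfl)) va vs vr
    constructor
    · intro H k
      exact (this _).1 (H _)
    · intro H i
      have := (this (e.symm (e i))).2 (H (e i))
      rwa [e.symm_apply_apply] at this
  | all x φ ih =>
    intro ok
    obtain ⟨c, hc⟩ := ih ok
    exact ⟨.all x c, fun M S S0 hM va vs vr => forall_congr' fun a => hc M S S0 hM _ vs vr⟩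
  | qAA x φ ih =>
    intro ok
    obtain ⟨c, hc⟩ := ih ok.2
    refine ⟨.qAA x c, fun M S S0 hM va vs vr => ?_⟩
    simp only [dec, Eval]
    refine exists_congr fun C => and_congr_right fun _ => forall_congr' fun T =>
      forall_congr' fun _ => hc M S S0 hM va _ vr
  | qC x φ ih => intro ok; exact ok.1.elim
  | qWo x y φ ih => intro ok; exact ok.1.elim
  | qII x φ ih => intro ok; exact ok.1.elim
  | qCf x y φ ih => intro ok; exact ok.1.elim

lemma hanfVal_le_code (φ : Fml L) (ok : Ok Laa φ) (hb : BddSpec φ) :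
    ∃ c : Code, hanfVal φ ≤ max 1 (hanfVal (dec c)) := by
  classical
  obtain ⟨hu1, hu2⟩ := used_countable φ ok
  obtain ⟨g, hg⟩ := Set.countable_iff_exists_injOn.1 hu1
  obtain ⟨h, hh⟩ := Set.countable_iff_exists_injOn.1 hu2
  obtain ⟨c, hc⟩ := exists_code g h φ ok
  refine ⟨c, csSup_le' ?_⟩
  have hb' : BddSpec (dec c) := by
    obtain ⟨κ, hκ⟩ := hb
    refine ⟨κ, fun M S0 hM => ?_⟩
    let S : L.Structure M :=
      { funMap := fun {n} f xs => S0.funMap (f0 n (g ⟨n, f⟩)) xs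
        RelMap := fun {n} R xs => S0.RelMap (r0 n (h ⟨n, R⟩)) xs }
    refine hκ M S fun va vs vr => ?_
    exact (hc M S S0 ⟨fun _ _ _ _ => rfl, fun _ _ _ _ => Iff.rfl⟩ va vs vr).2 (hM va vs vr)
  rintro _ ⟨M, S, hM, rfl⟩
  rcases isEmpty_or_nonempty M with hE | ⟨⟨m0⟩⟩
  · refine le_trans ?_ (le_max_left _ _)
    rw [Cardinal.mk_eq_zero, Cardinal.succ_zero]
  · refine le_trans ?_ (le_max_right _ _)
    let S0 : L0.Structure M :=
      { funMap := fun {n} (k : ℕ) xs =>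
          if H : ∃ f : L.Functions n, (⟨n, f⟩ : Σ n, L.Functions n) ∈ uf φ ∧ g ⟨n, f⟩ = k then
            S.funMap H.choose xs else m0
        RelMap := fun {n} (k : ℕ) xs =>
          ∃ R : L.Relations n, (⟨n, R⟩ : Σ n, L.Relations n) ∈ ur φ ∧ h ⟨n, R⟩ = k ∧
            S.RelMap R xs }
    refine mk_lt_hanfVal _ hb' M S0 fun va vs vr => ?_
    refine (hc M S S0 ⟨?_, ?_⟩ va vs vr).1 (hM va vs vr)
    · intro n f hf xs
      have H : ∃ f' : L.Functions n, (⟨n, f'⟩ : Σ n, L.Functions n) ∈ uf φ ∧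
        g ⟨n, f'⟩ = g ⟨n, f⟩ := ⟨f, hf, rfl⟩
      have e1 : H.choose = f := by
        have := hg H.choose_spec.1 hf H.choose_spec.2
        simpa using this
      have e2 : S0.funMap (f0 n (g ⟨n, f⟩)) xs = S.funMap H.choose xs := dif_pos H
      rw [e2, e1]
    · intro n R hR xs
      constructor
      · intro hx
        exact ⟨R, hR, rfl, hx⟩
      · rintro ⟨R', hR', he, hx⟩
        have := hh hR' hR he
        have : R' = R := by simpa using this
        rwa [← this]

lemma bdd_aa : BddAbove {c | ∃ (L : FirstOrder.Language.{0,0}) (φ : Fml L),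
    IsSentence φ ∧ Ok Laa φ ∧ BddSpec φ ∧ c = hanfVal φ} := by
  have hs : BddAbove (Set.range fun c : Code => hanfVal (dec c)) :=
    Cardinal.bddAbove_of_small
  obtain ⟨B, hB⟩ := hs
  refine ⟨max 1 B, ?_⟩
  rintro _ ⟨L, φ, _, ok, hb, rfl⟩
  obtain ⟨c, hc⟩ := hanfVal_le_code φ ok hb
  exact hc.trans (max_le_max le_rfl (hB ⟨c, rfl⟩))

/-- The Hanf number of the countable-set-quantifier logic is at most that of
stationary logic: `h(L^c_{ω,ω}) ≤ h(L^{aa}_{ω,ω})`. -/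
theorem hanf_c_le_hanf_aa : hanfNum Lc ≤ hanfNum Laa := by
  refine csSup_le' ?_
  rintro _ ⟨L, φ, hφ, ok, hb, rfl⟩
  refine (hanfVal_psi φ hφ ok hb).trans (le_csSup bdd_aa ?_)
  obtain ⟨h1, h2, h3, h4⟩ := cl_psi φ hφ ok
  exact ⟨LX L, psi φ, ⟨Set.subset_empty_iff.1 h1, Set.subset_empty_iff.1 h2, h3⟩, h4,
    bdd_psi φ hφ ok hb, rfl⟩

end Hanf
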